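/- Let Q, T, N ≥ 2 be real numbers, fix an integer j ≥ 2, fix δ > 0 and σ₀ ∈ (0,1). For each χ ∈ O_j(Q) let 𝒯_χ ⊂ [δ/2 − T, T − δ/2] be a finite set of reals with |t − t'| ≥ δ for distinct t, t' ∈ 𝒯_χ, for each t ∈ 𝒯_χ choose σ_t ∈ [σ₀, 1), and set 𝒮_χ = { σ_t + it : t ∈ 𝒯_χ }. Let 𝒮(Q) be the set of pairs (s, χ) with χ ∈ O_j(Q) and s ∈ 𝒮_χ. Then for any complex numbers (a_n) and any ε > 0 there is a constant C(ε) > 0 (depending on ε alone) such that ∑_{(s,χ) ∈ 𝒮(Q)} | ∑_{n ≤ N, n squarefree} a_n χ(n) n^{−s} |² ≤ C(ε) (δ^{−1} + 1)(QTN)^{ε} ( N + Q T^{1/2} |𝒮(Q)| ) ∑_{n ≤ N, n squarefree} |a_n|² n^{−2σ₀}. -/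

import Mathlib

open Complex

/-- The Dirichlet L-function of a character mod `q`, extended by zero to `q = 0`. -/
noncomputable def LFun (q : ℕ) (χ : DirichletCharacter ℂ q) (s : ℂ) : ℂ :=
  if h : q = 0 then 0
  else
    letI : NeZero q := ⟨h⟩
    DirichletCharacter.LFunction χ s

/-- `χ` mod `q` belongs to the family `O_j(Q)`: it is primitive, has multiplicative order
exactly `j`, and (being primitive) its conductor `q` satisfies `Q < q ≤ 2Q`. -/
def inFamily (j : ℕ) (Q : ℝ) (q : ℕ) (χ : DirichletCharacter ℂ q) : Prop :=
  χ.IsPrimitive ∧ orderOf χ = j ∧ Q < (q : ℝ) ∧ (q : ℝ) ≤ 2 * Q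

theorem differentiableAt_integral_cpow_mul_cexp {a z : ℂ} (ha : 0 < a.re) (hz : 0 < z.re) :
    DifferentiableAt ℂ
      (fun w : ℂ => ∫ x in Set.Ioi (0 : ℝ), (x : ℂ) ^ (a - 1) * cexp (-(w * x))) z := by
  have hcont : ∀ w b : ℂ,
      ContinuousOn (fun x : ℝ => (x : ℂ) ^ b * cexp (-(w * x))) (Set.Ioi (0 : ℝ)) := by
    intro w b
    refine ContinuousOn.mul (fun x hx => ?_) (by fun_prop)
    exact (continuousAt_ofReal_cpow_const x b (Or.inr (ne_of_gt hx))).continuousWithinAt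
  have hmeas : ∀ w b : ℂ, MeasureTheory.AEStronglyMeasurable
      (fun x : ℝ => (x : ℂ) ^ b * cexp (-(w * x)))
      (MeasureTheory.volume.restrict (Set.Ioi (0 : ℝ))) := fun w b =>
    (hcont w b).aestronglyMeasurable measurableSet_Ioi
  have hint : ∀ (s b : ℝ), -1 < s → 0 < b →
      MeasureTheory.IntegrableOn (fun x : ℝ => x ^ s * Real.exp (-b * x)) (Set.Ioi 0) := by
    intro s b hs hb
    simpa using integrableOn_rpow_mul_exp_neg_mul_rpow hs (zero_lt_one' ℝ) hb
  have hnorm : ∀ (w b : ℂ) (x : ℝ), 0 < x →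
      ‖(x : ℂ) ^ b * cexp (-(w * x))‖ = x ^ b.re * Real.exp (-w.re * x) := by
    intro w b x hx
    rw [norm_mul, Complex.norm_cpow_eq_rpow_re_of_pos hx, Complex.norm_exp]
    simp
  refine (hasDerivAt_integral_of_dominated_loc_of_deriv_le
    (F' := fun (w : ℂ) (x : ℝ) => -((x : ℂ) ^ a * cexp (-(w * x))))
    (bound := fun x : ℝ => x ^ a.re * Real.exp (-(z.re / 2) * x))
    (s := Metric.ball z (z.re / 2)) (Metric.ball_mem_nhds z (by positivity))
    (Filter.Eventually.of_forall fun w => hmeas w (a - 1)) ?_ (hmeas z a).neg ?_ ?_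
    ?_).2.differentiableAt
  · refine MeasureTheory.Integrable.mono' (hint (a.re - 1) z.re (by linarith) hz)
      (hmeas z (a - 1)) ?_
    filter_upwards [MeasureTheory.ae_restrict_mem measurableSet_Ioi] with x hx
    rw [hnorm z (a - 1) x hx]
    simp
  · filter_upwards [MeasureTheory.ae_restrict_mem measurableSet_Ioi] with x hx w hw
    rw [norm_neg, hnorm w a x hx]
    have hx' : (0 : ℝ) < x := hx
    have h1 : |(w - z).re| < z.re / 2 :=
      (Complex.abs_re_le_norm _).trans_lt (by simpa [dist_eq_norm] using hw)
    have h2 : z.re / 2 ≤ w.re := by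
      have := (abs_lt.1 h1).1
      simp at this
      linarith
    gcongr
  · exact hint a.re (z.re / 2) (by linarith) (by positivity)
  · filter_upwards [MeasureTheory.ae_restrict_mem measurableSet_Ioi] with x hx w _
    have hx' : (x : ℂ) ≠ 0 := by exact_mod_cast (ne_of_gt hx)
    have h : HasDerivAt (fun w : ℂ => cexp (-(w * x))) (cexp (-(w * x)) * (-(1 * (x : ℂ)))) w :=
      (((hasDerivAt_id w).mul_const (x : ℂ)).neg).cexp
    convert! h.const_mul ((x : ℂ) ^ (a - 1)) using 1
    rw [Complex.cpow_sub _ _ hx', Complex.cpow_one]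
    field_simp

theorem integral_cpow_mul_cexp_neg_mul {a z : ℂ} (ha : 0 < a.re) (hz : 0 < z.re) :
    ∫ x in Set.Ioi (0 : ℝ), (x : ℂ) ^ (a - 1) * cexp (-(z * x)) = Gamma a * z ^ (-a) := by
  have hopen : IsOpen {w : ℂ | 0 < w.re} := isOpen_lt continuous_const Complex.continuous_re
  have hF : AnalyticOnNhd ℂ
      (fun w : ℂ => ∫ x in Set.Ioi (0 : ℝ), (x : ℂ) ^ (a - 1) * cexp (-(w * x)))
      {w : ℂ | 0 < w.re} :=
    DifferentiableOn.analyticOnNhd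
      (fun w hw => (differentiableAt_integral_cpow_mul_cexp ha hw).differentiableWithinAt) hopen
  have hG : AnalyticOnNhd ℂ (fun w : ℂ => Gamma a * w ^ (-a)) {w : ℂ | 0 < w.re} := by
    refine DifferentiableOn.analyticOnNhd (fun w hw => ?_) hopen
    refine DifferentiableAt.differentiableWithinAt ?_
    exact (DifferentiableAt.cpow_const differentiableAt_id (Or.inl hw)).const_mul _
  have hpre : IsPreconnected {w : ℂ | 0 < w.re} :=
    (convex_halfSpace_re_gt 0).isPreconnected
  refine hF.eqOn_of_preconnected_of_frequently_eq hG hpre (z₀ := 1) (by simp) ?_ hz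
  have htend : Filter.Tendsto (fun r : ℝ => (r : ℂ)) (nhdsWithin 1 {1}ᶜ)
      (nhdsWithin (1 : ℂ) {1}ᶜ) := by
    refine tendsto_nhdsWithin_of_tendsto_nhds_of_eventually_within _ ?_ ?_
    · exact (Complex.continuous_ofReal.tendsto' 1 1 (by simp)).mono_left nhdsWithin_le_nhds
    · filter_upwards [self_mem_nhdsWithin] with r hr
      simpa using hr
  refine htend.frequently (Filter.Eventually.frequently ?_)
  filter_upwards [nhdsWithin_le_nhds (lt_mem_nhds (zero_lt_one' ℝ))] with r hr
  rw [Complex.integral_cpow_mul_exp_neg_mul_Ioi ha hr, mul_comm, Complex.cpow_neg, one_div,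
    Complex.inv_cpow _ _ (by rw [Complex.arg_ofReal_of_nonneg hr.le]; exact Real.pi_pos.ne)]

theorem norm_Gamma_two_sub_le (t : ℝ) :
    ‖Gamma (2 - t * I)‖ ≤ 3 * (1 + |t|) ^ ((3 : ℝ) / 2) * Real.exp (-(Real.pi / 2 * |t|)) := by
  have hpi := Real.pi_pos
  rcases eq_or_ne t 0 with rfl | ht
  · simp
  have hI : (t : ℂ) * I ≠ 0 := by simp [ht]
  have h1 : Gamma (2 - t * I) = (1 - t * I) * Gamma (1 - t * I) := by
    have h : (1 : ℂ) - t * I ≠ 0 := fun h => by simpa using congrArg Complex.re h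
    rw [← Complex.Gamma_add_one _ h]
    congr 1
    ring
  have hconj : Gamma (1 + t * I) = (starRingEnd ℂ) (Gamma (1 - t * I)) := by
    rw [← Complex.Gamma_conj]
    congr 1
    simp
  have hsinh : 0 < |Real.sinh (Real.pi * t)| := abs_pos.2 (by simp [ht, hpi.ne'])
  have h2 : ‖Gamma (1 - t * I)‖ ^ 2 = Real.pi * |t| / |Real.sinh (Real.pi * t)| := by
    have h3 : ‖Gamma (1 - t * I)‖ ^ 2 = ‖Gamma (1 + t * I) * Gamma (1 - t * I)‖ := by
      rw [norm_mul, hconj, RCLike.norm_conj, sq]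
    rw [h3, add_comm, Complex.Gamma_add_one _ hI, mul_assoc, Complex.Gamma_mul_Gamma_one_sub,
      ← mul_assoc (Real.pi : ℂ), Complex.sin_mul_I, ← Complex.ofReal_mul, ← Complex.ofReal_sinh]
    simp [abs_of_pos hpi, -Complex.ofReal_sinh, -Complex.ofReal_mul]
    ring
  have h4 : |t| / |Real.sinh (Real.pi * t)| ≤ 2 * (1 + |t|) * Real.exp (-(Real.pi * |t|)) := by
    have habs : |Real.sinh (Real.pi * t)| = Real.sinh (Real.pi * |t|) := by
      rw [Real.abs_sinh, abs_mul, abs_of_pos hpi]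
    have htp : 0 < |t| := abs_pos.2 ht
    set u := |t|
    rw [habs] at hsinh ⊢
    rw [div_le_iff₀ hsinh, Real.sinh_eq]
    have hE : Real.exp (-(Real.pi * u)) * Real.exp (Real.pi * u) = 1 := by
      rw [← Real.exp_add]; simp
    have hs : Real.exp (-(Real.pi * u)) ^ 2 * (1 + 2 * (Real.pi * u)) ≤ 1 := by
      have := Real.add_one_le_exp (2 * (Real.pi * u))
      have h5 : Real.exp (2 * (Real.pi * u)) = Real.exp (Real.pi * u) ^ 2 := by
        rw [← Real.exp_nat_mul]; norm_num
      calc _ ≤ Real.exp (-(Real.pi * u)) ^ 2 * Real.exp (Real.pi * u) ^ 2 := by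
            gcongr; linarith
        _ = 1 := by rw [← mul_pow, hE, one_pow]
    have hpi3 := Real.pi_gt_three
    have h6 : 2 * (1 + u) * Real.exp (-(Real.pi * u)) *
        ((Real.exp (Real.pi * u) - Real.exp (-(Real.pi * u))) / 2)
        = (1 + u) * (1 - Real.exp (-(Real.pi * u)) ^ 2) := by
      linear_combination (1 + u) * hE
    rw [h6]
    have hpu : 0 < Real.pi * u := by positivity
    have h7 : Real.exp (-(Real.pi * u)) ^ 2 ≤ 1 / (1 + 2 * (Real.pi * u)) := by
      rw [le_div_iff₀ (by positivity)]; exact hs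
    have h8 : u ≤ (1 + u) * (1 - 1 / (1 + 2 * (Real.pi * u))) := by
      rw [one_sub_div (by positivity), ← mul_div_assoc, le_div_iff₀ (by positivity)]
      nlinarith
    exact h8.trans (by gcongr)
  have h9 : ‖(1 : ℂ) - t * I‖ ≤ 1 + |t| := by
    refine (norm_sub_le _ _).trans ?_
    simp
  have h10 : ‖Gamma (2 - t * I)‖ ^ 2 ≤
      (3 * (1 + |t|) ^ ((3 : ℝ) / 2) * Real.exp (-(Real.pi / 2 * |t|))) ^ 2 := by
    have e1 : ((1 + |t|) ^ ((3 : ℝ) / 2)) ^ 2 = (1 + |t|) ^ 3 := by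
      rw [← Real.rpow_natCast, ← Real.rpow_mul (by positivity), ← Real.rpow_natCast]
      norm_num
    have e2 : Real.exp (-(Real.pi / 2 * |t|)) ^ 2 = Real.exp (-(Real.pi * |t|)) := by
      rw [← Real.exp_nat_mul]
      congr 1
      push_cast
      ring
    rw [mul_pow, mul_pow, e1, e2, h1, norm_mul, mul_pow, h2, mul_div_assoc]
    calc _ ≤ (1 + |t|) ^ 2 *
          (Real.pi * (2 * (1 + |t|) * Real.exp (-(Real.pi * |t|)))) := by gcongr
      _ = (2 * Real.pi) * ((1 + |t|) ^ 3 * Real.exp (-(Real.pi * |t|))) := by ring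
      _ ≤ 9 * ((1 + |t|) ^ 3 * Real.exp (-(Real.pi * |t|))) := by
        gcongr; linarith [Real.pi_lt_four, Real.pi_lt_d2]
      _ = _ := by ring
  exact (pow_le_pow_iff_left₀ (norm_nonneg _) (by positivity) two_ne_zero).1 h10

/-- The smooth weight `(x / M) * exp (-x / M)` twisted by `x ^ (-i t)`, supported on `x > 0`. -/
noncomputable def twistedWeight (M t x : ℝ) : ℂ :=
  ((max x 0 : ℝ) : ℂ) ^ (1 - t * I) * (Real.exp (-(x / M)) / M : ℝ)

theorem twistedWeight_of_nonpos {M t x : ℝ} (hx : x ≤ 0) : twistedWeight M t x = 0 := by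
  have h : (1 : ℂ) - t * I ≠ 0 := fun h => by simpa using congrArg Complex.re h
  simp [twistedWeight, max_eq_right hx, Complex.zero_cpow h]

theorem twistedWeight_of_pos {M t x : ℝ} (hx : 0 < x) :
    twistedWeight M t x = (x : ℂ) ^ (1 - t * I) * (Real.exp (-(x / M)) / M : ℝ) := by
  simp [twistedWeight, max_eq_left hx.le]

theorem continuous_twistedWeight (M t : ℝ) : Continuous (twistedWeight M t) := by
  unfold twistedWeight
  have h : Continuous fun x : ℝ => (x : ℂ) ^ (1 - t * I) :=
    Complex.continuous_ofReal_cpow_const (by simp)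
  exact (h.comp (by fun_prop : Continuous fun x : ℝ => max x 0)).mul (by fun_prop)

theorem norm_twistedWeight_of_pos {M t x : ℝ} (hM : 0 < M) (hx : 0 < x) :
    ‖twistedWeight M t x‖ = x / M * Real.exp (-(x / M)) := by
  rw [twistedWeight_of_pos hx, norm_mul, Complex.norm_cpow_eq_rpow_re_of_pos hx, Complex.norm_real,
    Real.norm_of_nonneg (by positivity)]
  simp
  ring

theorem twistedWeight_mul {M t d x : ℝ} (hd : 0 < d) :
    twistedWeight M t (d * x) = (d : ℂ) ^ (-(t * I)) * twistedWeight (M / d) t x := by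
  rcases le_or_gt x 0 with hx | hx
  · rw [twistedWeight_of_nonpos hx,
      twistedWeight_of_nonpos (mul_nonpos_of_nonneg_of_nonpos hd.le hx),
      mul_zero]
  · have hd' : (d : ℂ) ≠ 0 := by exact_mod_cast hd.ne'
    rw [twistedWeight_of_pos hx, twistedWeight_of_pos (by positivity), Complex.ofReal_mul,
      Complex.mul_cpow_ofReal_nonneg hd.le hx.le, sub_eq_add_neg (1 : ℂ),
      Complex.cpow_add _ _ hd', Complex.cpow_one]
    have : x / (M / d) = d * x / M := by field_simp
    rw [this]
    push_cast
    field_simp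

theorem twistedWeight_isBigO {M : ℝ} (hM : 0 < M) (t : ℝ) :
    twistedWeight M t =O[Filter.cocompact ℝ] fun x => |x| ^ (-2 : ℝ) := by
  refine Asymptotics.IsBigO.of_bound (6 * M ^ 2) ?_
  have : ∀ᶠ x : ℝ in Filter.cocompact ℝ, x ≠ 0 := by
    have := (isCompact_singleton (x := (0 : ℝ))).compl_mem_cocompact
    filter_upwards [this] with x hx using hx
  filter_upwards [this] with x hx
  rcases lt_or_gt_of_ne hx with hx | hx
  · rw [twistedWeight_of_nonpos hx.le, norm_zero]
    positivity
  · rw [norm_twistedWeight_of_pos hM hx, Real.norm_of_nonneg (by positivity), abs_of_pos hx,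
      Real.rpow_neg hx.le, Real.rpow_ofNat, ← div_eq_mul_inv, le_div_iff₀ (by positivity)]
    have h := Real.pow_div_factorial_le_exp (x / M) (by positivity) 3
    have h3 : ((Nat.factorial 3 : ℕ) : ℝ) = 6 := by norm_num [Nat.factorial]
    rw [h3, div_le_iff₀ (by norm_num)] at h
    calc x / M * Real.exp (-(x / M)) * x ^ 2
        = M ^ 2 * (x / M) ^ 3 * Real.exp (-(x / M)) := by field_simp
      _ ≤ M ^ 2 * (Real.exp (x / M) * 6) * Real.exp (-(x / M)) := by gcongr
      _ = 6 * M ^ 2 * (Real.exp (x / M) * Real.exp (-(x / M))) := by ring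
      _ = 6 * M ^ 2 := by rw [← Real.exp_add]; simp

open FourierTransform in
theorem fourier_twistedWeight {M : ℝ} (hM : 0 < M) (t y : ℝ) :
    𝓕 (twistedWeight M t) y =
      Gamma (2 - t * I) * ((1 / M : ℝ) + (2 * Real.pi * y : ℝ) * I) ^ (-(2 - t * I)) / M := by
  set z : ℂ := (1 / M : ℝ) + (2 * Real.pi * y : ℝ) * I with hz
  have hzre : z.re = 1 / M := by simp [hz]
  rw [Real.fourier_real_eq_integral_exp_smul,
    ← integral_cpow_mul_cexp_neg_mul (by simp) (by rw [hzre]; positivity), div_eq_mul_inv,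
    ← MeasureTheory.integral_mul_const]
  rw [← MeasureTheory.setIntegral_eq_integral_of_forall_compl_eq_zero
    (s := Set.Ioi (0 : ℝ)) (fun x hx => by
      rw [twistedWeight_of_nonpos (not_lt.1 hx), smul_zero])]
  refine MeasureTheory.setIntegral_congr_fun measurableSet_Ioi fun x hx => ?_
  simp only [smul_eq_mul]
  have e : cexp (-(z * x)) = cexp (((-2 * Real.pi * x * y : ℝ) : ℂ) * I) * cexp (-(x / M)) := by
    rw [← Complex.exp_add, hz]
    congr 1
    push_cast
    ring
  rw [twistedWeight_of_pos hx, e, show (2 : ℂ) - t * I - 1 = 1 - t * I by ring]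
  push_cast
  ring

theorem norm_cpow_neg_two_sub_le {z : ℂ} (hz : 0 < z.re) (t : ℝ) :
    ‖z ^ (-(2 - t * I))‖ ≤
      (‖z‖ ^ 2)⁻¹ * (Real.exp (Real.pi / 2 * |t|) * Real.exp (-(|t| * (z.re / ‖z‖)))) := by
  have hz0 : z ≠ 0 := fun h => by simp [h] at hz
  rw [Complex.norm_cpow_of_ne_zero hz0, div_eq_mul_inv, ← Real.exp_neg, ← Real.exp_add]
  have hre : (-(2 - t * I)).re = (-2 : ℝ) := by simp
  have him : (-(2 - t * I)).im = t := by simp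
  rw [hre, him, Real.rpow_neg (norm_nonneg _), Real.rpow_ofNat]
  gcongr
  have hcos := Complex.cos_arg hz0
  have hpi : |z.arg| < Real.pi / 2 := Complex.abs_arg_lt_pi_div_two_iff.2 (Or.inl hz)
  have h1 : z.re / ‖z‖ ≤ Real.pi / 2 - |z.arg| := by
    rw [← hcos, ← Real.cos_abs, ← Real.sin_pi_div_two_sub]
    exact Real.sin_le (by linarith)
  have h2 : -(z.arg * t) ≤ |z.arg| * |t| := by
    rw [← abs_mul]; exact neg_le_abs _
  nlinarith [abs_nonneg t]

theorem sq_mul_exp_neg_le {u : ℝ} (hu : 0 ≤ u) :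
    u ^ 2 * Real.exp (-u) ≤ 2 * (u / (1 + u)) ^ 2 := by
  have h := Real.quadratic_le_exp_of_nonneg hu
  rw [Real.exp_neg, ← div_eq_mul_inv, div_pow, div_le_iff₀ (Real.exp_pos _)]
  have : 2 * (u ^ 2 / (1 + u) ^ 2) * Real.exp u
    ≥ 2 * (u ^ 2 / (1 + u) ^ 2) * ((1 + u) ^ 2 / 2) := by
    gcongr
    nlinarith
  refine le_trans (le_of_eq ?_) this
  field_simp

open FourierTransform in
theorem norm_fourier_twistedWeight_le_exp {M : ℝ} (hM : 0 < M) (t y : ℝ) {v : ℝ}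
    (hv : v = M * ‖((1 / M : ℝ) + (2 * Real.pi * y : ℝ) * I : ℂ)‖) :
    ‖𝓕 (twistedWeight M t) y‖ ≤
      3 * (1 + |t|) ^ ((3 : ℝ) / 2) * M * ((v ^ 2)⁻¹ * Real.exp (-(|t| / v))) := by
  rw [fourier_twistedWeight hM]
  set z : ℂ := (1 / M : ℝ) + (2 * Real.pi * y : ℝ) * I with hz
  have hzre : z.re = 1 / M := by simp [hz]
  have hzpos : 0 < z.re := by rw [hzre]; positivity
  have hzn : 0 < ‖z‖ := norm_pos_iff.2 fun h => by simp [h] at hzpos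
  rw [norm_div, norm_mul, Complex.norm_real, Real.norm_of_nonneg hM.le]
  calc _ ≤ (3 * (1 + |t|) ^ ((3 : ℝ) / 2) * Real.exp (-(Real.pi / 2 * |t|))) *
        ((‖z‖ ^ 2)⁻¹ * (Real.exp (Real.pi / 2 * |t|) * Real.exp (-(|t| * (z.re / ‖z‖))))) / M := by
        gcongr
        · exact norm_Gamma_two_sub_le t
        · exact norm_cpow_neg_two_sub_le hzpos t
    _ = (3 * (1 + |t|) ^ ((3 : ℝ) / 2)) * (Real.exp (-(Real.pi / 2 * |t|)) *
        Real.exp (Real.pi / 2 * |t|)) * ((‖z‖ ^ 2)⁻¹ * Real.exp (-(|t| * (z.re / ‖z‖)))) / M := by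
        ring
    _ = _ := by
        rw [← Real.exp_add, neg_add_cancel, Real.exp_zero, hzre, hv]
        have : |t| * (1 / M / ‖z‖) = |t| / (M * ‖z‖) := by field_simp
        rw [this]
        field_simp

open FourierTransform in
/-- Bound for the Fourier transform of the twisted weight, of the quality of stationary phase. -/
theorem norm_fourier_twistedWeight_le {M : ℝ} (hM : 0 < M) (t y : ℝ) :
    ‖𝓕 (twistedWeight M t) y‖ ≤
      18 * (1 + |t|) ^ (-(1 : ℝ) / 2) * M *
        ((1 + |t|) / ((1 + |t|) + M * |y|)) ^ 2 := by
  set v := M * ‖((1 / M : ℝ) + (2 * Real.pi * y : ℝ) * I : ℂ)‖ with hv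
  refine (norm_fourier_twistedWeight_le_exp hM t y hv).trans ?_
  have hv1 : 1 ≤ v := by
    have := Complex.re_le_norm ((1 / M : ℝ) + (2 * Real.pi * y : ℝ) * I : ℂ)
    have h2 : ((1 / M : ℝ) + (2 * Real.pi * y : ℝ) * I : ℂ).re = 1 / M := by simp
    rw [h2] at this
    calc 1 = M * (1 / M) := by field_simp
      _ ≤ v := by rw [hv]; gcongr
  have hv2 : M * |y| ≤ v := by
    have := Complex.abs_im_le_norm ((1 / M : ℝ) + (2 * Real.pi * y : ℝ) * I : ℂ)
    have h2 : ((1 / M : ℝ) + (2 * Real.pi * y : ℝ) * I : ℂ).im = 2 * Real.pi * y := by simp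
    rw [h2, abs_mul, abs_of_pos (by positivity)] at this
    rw [hv]
    gcongr
    refine le_trans ?_ this
    nlinarith [abs_nonneg y, Real.pi_gt_three]
  set τ := 1 + |t| with hτ
  have hτ1 : 1 ≤ τ := by have := abs_nonneg t; linarith
  have hvp : 0 < v := by linarith
  have h1 : Real.exp (-(|t| / v)) ≤ 3 * Real.exp (-(τ / v)) := by
    have h3 : Real.exp 1 ≤ 3 := by linarith [Real.exp_one_lt_d9]
    calc Real.exp (-(|t| / v)) ≤ Real.exp (1 + -(τ / v)) := by
          gcongr
          have : τ / v = 1 / v + |t| / v := by rw [hτ]; ring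
          have h4 : 1 / v ≤ 1 := by rw [div_le_one hvp]; exact hv1
          linarith
      _ = Real.exp 1 * Real.exp (-(τ / v)) := Real.exp_add _ _
      _ ≤ _ := by gcongr
  have h2 := sq_mul_exp_neg_le (u := τ / v) (by positivity)
  have h5 : τ / v / (1 + τ / v) = τ / (τ + v) := by field_simp; ring
  rw [h5] at h2
  have h6 : τ ^ ((3 : ℝ) / 2) = τ ^ (-(1 : ℝ) / 2) * τ ^ 2 := by
    rw [← Real.rpow_natCast, ← Real.rpow_add (by positivity)]
    norm_num
  calc 3 * τ ^ ((3 : ℝ) / 2) * M * ((v ^ 2)⁻¹ * Real.exp (-(|t| / v)))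
      ≤ 3 * τ ^ ((3 : ℝ) / 2) * M * ((v ^ 2)⁻¹ * (3 * Real.exp (-(τ / v)))) := by gcongr
    _ = 9 * τ ^ (-(1 : ℝ) / 2) * M * ((τ / v) ^ 2 * Real.exp (-(τ / v))) := by
        rw [h6]; field_simp; ring
    _ ≤ 9 * τ ^ (-(1 : ℝ) / 2) * M * (2 * (τ / (τ + v)) ^ 2) := by gcongr
    _ = 18 * τ ^ (-(1 : ℝ) / 2) * M * (τ / (τ + v)) ^ 2 := by ring
    _ ≤ _ := by gcongr

open FourierTransform in
theorem norm_fourier_twistedWeight_zero_le {M : ℝ} (hM : 0 < M) (t : ℝ) :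
    ‖𝓕 (twistedWeight M t) 0‖ ≤ 216 * M * ((1 + |t|) ^ 2)⁻¹ := by
  have hv : (1 : ℝ) = M * ‖((1 / M : ℝ) + (2 * Real.pi * 0 : ℝ) * I : ℂ)‖ := by
    simp [abs_of_pos hM]
    field_simp
  refine (norm_fourier_twistedWeight_le_exp hM t 0 hv).trans ?_
  have h0 := abs_nonneg t
  have h3 : Real.exp 1 ≤ 3 := by linarith [Real.exp_one_lt_d9]
  set τ := 1 + |t| with hτ
  have hτ1 : 1 ≤ τ := by linarith
  have h4 : τ ^ ((3 : ℝ) / 2) ≤ τ ^ 2 := by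
    rw [← Real.rpow_natCast]
    exact Real.rpow_le_rpow_of_exponent_le hτ1 (by norm_num)
  have h5 := Real.pow_div_factorial_le_exp τ (by positivity) 4
  have h6 : ((Nat.factorial 4 : ℕ) : ℝ) = 24 := by norm_num [Nat.factorial]
  rw [h6, div_le_iff₀ (by norm_num)] at h5
  have h7 : Real.exp (-|t|) = Real.exp 1 * (Real.exp τ)⁻¹ := by
    rw [← Real.exp_neg, ← Real.exp_add]; congr 1; rw [hτ]; ring
  simp only [one_pow, inv_one, one_mul, div_one]
  rw [h7, ← div_eq_mul_inv (216 * M), le_div_iff₀ (by positivity)]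
  calc 3 * τ ^ ((3 : ℝ) / 2) * M * (Real.exp 1 * (Real.exp τ)⁻¹) * τ ^ 2
      ≤ 3 * τ ^ 2 * M * (3 * (Real.exp τ)⁻¹) * τ ^ 2 := by gcongr
    _ = 9 * M * (τ ^ 4 * (Real.exp τ)⁻¹) := by ring
    _ ≤ 9 * M * ((Real.exp τ * 24) * (Real.exp τ)⁻¹) := by gcongr
    _ = 216 * M := by field_simp; ring

theorem sum_range_sq_div_add_le {X : ℝ} (hX : 0 < X) (K : ℕ) :
    ∑ k ∈ Finset.range K, (X / (X + (k + 1))) ^ 2 ≤ X - X ^ 2 / (X + K) := by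
  induction K with
  | zero => simp; field_simp; simp
  | succ K ih =>
    rw [Finset.sum_range_succ]
    have h : (X / (X + (K + 1))) ^ 2 ≤ X ^ 2 / (X + K) - X ^ 2 / (X + (K + 1)) := by
      rw [div_sub_div _ _ (by positivity) (by positivity), div_pow,
        div_le_div_iff₀ (by positivity) (by positivity)]
      have : X ^ 2 * (X + (K + 1)) - (X + K) * X ^ 2 = X ^ 2 := by ring
      rw [this]
      gcongr
      nlinarith [(Nat.cast_nonneg K : (0 : ℝ) ≤ K)]
    push_cast
    linarith

theorem sum_range_sq_div_add_le_self {X : ℝ} (hX : 0 < X) (K : ℕ) :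
    ∑ k ∈ Finset.range K, (X / (X + (k + 1))) ^ 2 ≤ X :=
  (sum_range_sq_div_add_le hX K).trans (sub_le_self _ (by positivity))

theorem summable_sq_div_add {X : ℝ} (hX : 0 < X) :
    Summable fun k : ℕ => (X / (X + (k + 1))) ^ 2 :=
  summable_of_sum_range_le (fun _ => by positivity) (sum_range_sq_div_add_le_self hX)

theorem norm_tsum_int_le {f : ℤ → ℂ} {B₀ B X : ℝ} (hX : 0 < X) (hB : 0 ≤ B) (h0 : ‖f 0‖ ≤ B₀)
    (hf : ∀ k : ℤ, k ≠ 0 → ‖f k‖ ≤ B * (X / (X + |(k : ℝ)|)) ^ 2) :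
    ‖∑' k, f k‖ ≤ B₀ + 2 * (B * X) := by
  set S := ∑' k : ℕ, (X / (X + (k + 1))) ^ 2 with hS
  have hSX : S ≤ X := Real.tsum_le_of_sum_range_le (fun _ => by positivity)
    (sum_range_sq_div_add_le_self hX)
  have hs : HasSum (fun k : ℕ => B * (X / (X + (k + 1))) ^ 2) (B * S) :=
    (summable_sq_div_add hX).hasSum.mul_left B
  set g : ℤ → ℝ := fun k => if k = 0 then B₀ else B * (X / (X + |(k : ℝ)|)) ^ 2 with hg
  have hpos : ∀ n : ℕ, g (n + 1) = B * (X / (X + (n + 1))) ^ 2 := fun n => by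
    have h1 : ((n : ℤ) + 1) ≠ 0 := by positivity
    have h2 : |((n : ℝ) + 1)| = n + 1 := abs_of_nonneg (by positivity)
    simp [hg, h1, h2]
  have hneg : ∀ n : ℕ, g (-(n + 1)) = B * (X / (X + (n + 1))) ^ 2 := fun n => by
    have h1 : -((n : ℤ) + 1) ≠ 0 := neg_ne_zero.2 (by positivity)
    have h2 : |-1 + -(n : ℝ)| = n + 1 := by
      rw [← neg_add, abs_neg, abs_of_nonneg (by positivity), add_comm]
    simp only [hg, h1, if_false]
    push_cast
    rw [neg_add_rev, h2]
  have hsum : HasSum g (B * S + g 0 + B * S) :=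
    HasSum.of_add_one_of_neg_add_one (by simpa only [hpos] using hs)
      (by simpa only [hneg] using hs)
  refine (tsum_of_norm_bounded hsum fun k => ?_).trans ?_
  · by_cases hk : k = 0
    · simpa [hg, hk] using h0
    · simpa [hg, hk] using hf k hk
  · have : g 0 = B₀ := by simp [hg]
    rw [this]
    nlinarith

theorem norm_gaussSum_stdAddChar {m : ℕ} [NeZero m] {ψ : DirichletCharacter ℂ m}
    (hψ : ψ.IsPrimitive) : ‖gaussSum ψ ZMod.stdAddChar‖ ^ 2 = m := by
  have h : gaussSum ψ ZMod.stdAddChar * star (gaussSum ψ ZMod.stdAddChar) = m := by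
    rw [star_gaussSum_eq]
    calc gaussSum ψ ZMod.stdAddChar * gaussSum ψ⁻¹ (ZMod.stdAddChar)⁻¹
        = ∑ c, gaussSum ψ (ZMod.stdAddChar.mulShift c) * ZMod.stdAddChar (-c) := by
          rw [gaussSum, gaussSum, Finset.mul_sum]
          refine Finset.sum_congr rfl fun c _ => ?_
          rw [gaussSum_mulShift_of_isPrimitive _ hψ, gaussSum, AddChar.inv_apply]
          ring
      _ = ∑ x, ψ x * ∑ c, ZMod.stdAddChar (c * (x - 1)) := by
          simp_rw [gaussSum, Finset.sum_mul, Finset.mul_sum]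
          rw [Finset.sum_comm]
          refine Finset.sum_congr rfl fun x _ => Finset.sum_congr rfl fun c _ => ?_
          rw [AddChar.mulShift_apply, mul_assoc, ← AddChar.map_add_eq_mul]
          congr 2
          ring
      _ = m := by
          simp_rw [AddChar.sum_mulShift _ (ZMod.isPrimitive_stdAddChar m), sub_eq_zero]
          simp [ZMod.card]
  have h2 := congrArg norm h
  rw [norm_mul, norm_star, ← sq] at h2
  simpa using h2

theorem norm_gaussSum_mulShift_le {m : ℕ} [NeZero m] {ψ : DirichletCharacter ℂ m}
    (hψ : ψ.IsPrimitive) (a : ZMod m) :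
    ‖gaussSum ψ (ZMod.stdAddChar.mulShift a)‖ ≤ √m := by
  rw [gaussSum_mulShift_of_isPrimitive _ hψ, norm_mul, ← norm_gaussSum_stdAddChar hψ,
    Real.sqrt_sq (norm_nonneg _)]
  exact mul_le_of_le_one_left (norm_nonneg _) (DirichletCharacter.norm_le_one _ _)

theorem sum_fin_natCast_zmod {m : ℕ} [NeZero m] (F : ZMod m → ℂ) :
    ∑ c : Fin m, F ((c : ℕ) : ZMod m) = ∑ x, F x := by
  refine Fintype.sum_bijective (fun c : Fin m => ((c : ℕ) : ZMod m)) ?_ _ _ fun _ => rfl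
  rw [Fintype.bijective_iff_injective_and_card]
  refine ⟨fun a b h => ?_, by simp [ZMod.card]⟩
  have := congrArg ZMod.val h
  simp only [ZMod.val_natCast_of_lt a.2, ZMod.val_natCast_of_lt b.2] at this
  exact Fin.ext this

theorem summable_twistedWeight_int {M : ℝ} (hM : 0 < M) (t x : ℝ) :
    Summable fun n : ℤ => twistedWeight M t (x + n) := by
  have h := Real.summable_abs_int_rpow (b := 2) (by norm_num)
  have h1 := isBigO_norm_restrict_cocompact ⟨_, continuous_twistedWeight M t⟩ (zero_lt_two' ℝ)
    (twistedWeight_isBigO hM t) ⟨{x}, isCompact_singleton⟩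
  refine summable_of_isBigO h ((Asymptotics.IsBigO.trans ?_ (h1.comp_tendsto
    Int.tendsto_coe_cofinite)))
  refine Asymptotics.IsBigO.of_bound 1 (Filter.Eventually.of_forall fun n => ?_)
  simp only [Function.comp, one_mul]
  rw [norm_norm]
  refine le_trans (le_of_eq ?_) (ContinuousMap.norm_coe_le_norm _ ⟨x, Set.mem_singleton x⟩)
  simp

open FourierTransform in
theorem summable_fourier_twistedWeight {M : ℝ} (hM : 0 < M) (t : ℝ) :
    Summable fun n : ℤ => 𝓕 (twistedWeight M t) n := by
  have ht : 0 < 1 + |t| := by positivity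
  refine summable_of_isBigO (Real.summable_abs_int_rpow (b := 2) (by norm_num)) ?_
  refine Asymptotics.IsBigO.of_bound
    (18 * (1 + |t|) ^ (-(1 : ℝ) / 2) * M * ((1 + |t|) / M) ^ 2) ?_
  have h0 : ∀ᶠ n : ℤ in Filter.cofinite, n ≠ 0 :=
    (Set.finite_singleton (0 : ℤ)).compl_mem_cofinite
  filter_upwards [h0] with n hn
  have hn' : 0 < |(n : ℝ)| := abs_pos.2 (by exact_mod_cast hn)
  refine (norm_fourier_twistedWeight_le hM t n).trans ?_
  rw [Real.norm_of_nonneg (by positivity), Real.rpow_neg hn'.le, Real.rpow_ofNat,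
    mul_assoc _ (_ ^ 2),
    ← inv_pow, ← mul_pow]
  gcongr
  rw [div_mul_eq_mul_div, ← div_eq_mul_inv, div_div]
  gcongr
  linarith [mul_comm |(n : ℝ)| M]

open FourierTransform in
theorem tsum_character_mul_twistedWeight {m : ℕ} [NeZero m] (ψ : DirichletCharacter ℂ m)
    {M : ℝ} (hM : 0 < M) (t : ℝ) :
    ∑' n : ℤ, ψ n * twistedWeight M t n =
      (m : ℂ) ^ (-(t * I)) * ∑' k : ℤ, 𝓕 (twistedWeight (M / m) t) k *
        gaussSum ψ (ZMod.stdAddChar.mulShift k) := by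
  have hm : (0 : ℝ) < m := by exact_mod_cast NeZero.pos m
  have hP : 0 < M / m := by positivity
  have hsum : Summable fun n : ℤ => ψ n * twistedWeight M t n := by
    have h := summable_twistedWeight_int hM t 0
    simp only [zero_add] at h
    refine Summable.of_norm_bounded h.norm fun n => ?_
    rw [norm_mul]
    exact mul_le_of_le_one_left (norm_nonneg _) (DirichletCharacter.norm_le_one _ _)
  have hterm : ∀ (l : ℤ) (c : Fin m), ψ ((l * m + (c : ℕ) : ℤ) : ZMod m) *
      twistedWeight M t ((l * m + (c : ℕ) : ℤ) : ℝ) =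
      (m : ℂ) ^ (-(t * I)) * (ψ ((c : ℕ) : ZMod m) *
        twistedWeight (M / m) t (((c : ℕ) : ℝ) / m + l)) := by
    intro l c
    have e1 : ((l * m + (c : ℕ) : ℤ) : ZMod m) = ((c : ℕ) : ZMod m) := by simp
    have e2 : ((l * m + (c : ℕ) : ℤ) : ℝ) = m * (((c : ℕ) : ℝ) / m + l) := by
      push_cast; field_simp; ring
    rw [e1, e2, twistedWeight_mul hm]
    push_cast
    ring
  have hsum' := (Int.divModEquiv m).symm.summable_iff.2 hsum
  rw [← (Int.divModEquiv m).symm.tsum_eq]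
  refine (hsum'.tsum_prod).trans ?_
  simp only [Function.comp_apply]
  have h1 : ∀ l : ℤ, ∑' c : Fin m, ψ (((Int.divModEquiv m).symm (l, c) : ℤ) : ZMod m) *
      twistedWeight M t (((Int.divModEquiv m).symm (l, c) : ℤ) : ℝ) =
      ∑ c : Fin m, (m : ℂ) ^ (-(t * I)) * (ψ ((c : ℕ) : ZMod m) *
        twistedWeight (M / m) t (((c : ℕ) : ℝ) / m + l)) := by
    intro l
    rw [tsum_fintype]
    exact Finset.sum_congr rfl fun c _ => hterm l c
  simp_rw [h1]
  rw [Summable.tsum_finsetSum fun c _ =>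
    ((summable_twistedWeight_int hP t _).mul_left _).mul_left _]
  simp_rw [tsum_mul_left]
  rw [← Finset.mul_sum]
  congr 1
  have hpoisson : ∀ c : Fin m, ∑' l : ℤ, twistedWeight (M / m) t (((c : ℕ) : ℝ) / m + l) =
      ∑' k : ℤ, 𝓕 (twistedWeight (M / m) t) k *
        ZMod.stdAddChar ((k : ZMod m) * ((c : ℕ) : ZMod m)) := by
    intro c
    rw [Real.tsum_eq_tsum_fourier_of_rpow_decay_of_summable (continuous_twistedWeight _ t)
      one_lt_two (twistedWeight_isBigO hP t) (summable_fourier_twistedWeight hP t)]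
    refine tsum_congr fun k => ?_
    rw [fourier_coe_apply]
    have : (k : ZMod m) * ((c : ℕ) : ZMod m) = ((k * (c : ℕ) : ℤ) : ZMod m) := by push_cast; ring
    rw [this, ZMod.stdAddChar_coe]
    congr 2
    push_cast
    field_simp
  simp_rw [hpoisson, ← tsum_mul_left]
  have hs : ∀ c : Fin m, Summable fun k : ℤ => ψ ((c : ℕ) : ZMod m) *
      (𝓕 (twistedWeight (M / m) t) k *
        ZMod.stdAddChar ((k : ZMod m) * ((c : ℕ) : ZMod m))) := by
    intro c
    refine Summable.mul_left _ (Summable.of_norm_bounded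
      (summable_fourier_twistedWeight hP t).norm fun k => ?_)
    rw [norm_mul, AddChar.norm_apply, mul_one]
  rw [← Summable.tsum_finsetSum fun c _ => hs c]
  refine tsum_congr fun k => ?_
  rw [gaussSum, Finset.mul_sum, ← sum_fin_natCast_zmod]
  refine Finset.sum_congr rfl fun c _ => ?_
  rw [AddChar.mulShift_apply]
  ring

/-- Hybrid bound of Pólya–Vinogradov type, from Poisson summation: `√(m (1 + |t|))` without
logarithms for smoothly weighted sums of `ψ(n) n ^ (-i t)`. -/
theorem norm_tsum_primitive_mul_twistedWeight_le {m : ℕ} [NeZero m] {ψ : DirichletCharacter ℂ m}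
    (hψ : ψ.IsPrimitive) {M : ℝ} (hM : 0 < M) (t : ℝ) :
    ‖∑' n : ℤ, ψ n * twistedWeight M t n‖ ≤
      (if m = 1 then 216 * M * ((1 + |t|) ^ 2)⁻¹ else 0) + 36 * (√m * √(1 + |t|)) := by
  have hm : (0 : ℝ) < m := by exact_mod_cast NeZero.pos m
  have hP : 0 < M / m := by positivity
  have hτ : 0 < 1 + |t| := by positivity
  rw [tsum_character_mul_twistedWeight ψ hM t, norm_mul]
  have h1 : ‖(m : ℂ) ^ (-(t * I))‖ = 1 := by
    rw [Complex.norm_natCast_cpow_of_pos (NeZero.pos m)]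
    simp
  rw [h1, one_mul]
  refine (norm_tsum_int_le (X := (1 + |t|) / (M / m))
    (B := √m * (18 * (1 + |t|) ^ (-(1 : ℝ) / 2) * (M / m)))
    (B₀ := if m = 1 then 216 * M * ((1 + |t|) ^ 2)⁻¹ else 0)
    (by positivity) (by positivity) ?_ ?_).trans (le_of_eq ?_)
  · split_ifs with h
    · subst h
      rw [norm_mul]
      refine (mul_le_of_le_one_right (norm_nonneg _) ?_).trans ?_
      · simpa using norm_gaussSum_mulShift_le hψ ((0 : ℤ) : ZMod 1)
      · simpa using norm_fourier_twistedWeight_zero_le hM t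
    · have hψ1 : ψ ≠ 1 := by
        rintro rfl
        rw [DirichletCharacter.isPrimitive_def, DirichletCharacter.conductor_one] at hψ
        exact h hψ.symm
      have : gaussSum ψ (ZMod.stdAddChar.mulShift ((0 : ℤ) : ZMod m)) = 0 := by
        simp [gaussSum, MulChar.sum_eq_zero_of_ne_one hψ1]
      rw [this]
      simp
  · intro k _
    rw [norm_mul, mul_comm]
    calc _ ≤ √m * (18 * (1 + |t|) ^ (-(1 : ℝ) / 2) * (M / m) *
          ((1 + |t|) / ((1 + |t|) + (M / m) * |(k : ℝ)|)) ^ 2) := by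
          gcongr
          · exact norm_gaussSum_mulShift_le hψ _
          · exact norm_fourier_twistedWeight_le hP t k
      _ = _ := by
          have : (1 + |t|) / ((1 + |t|) + (M / m) * |(k : ℝ)|) =
              (1 + |t|) / (M / m) / ((1 + |t|) / (M / m) + |(k : ℝ)|) := by
            field_simp
          rw [this]
          ring
  · have : √(1 + |t|) = (1 + |t|) ^ (-(1 : ℝ) / 2) * (1 + |t|) := by
      nth_rewrite 3 [← Real.rpow_one (1 + |t|)]
      rw [← Real.rpow_add hτ, Real.sqrt_eq_rpow]
      norm_num
    rw [this]
    field_simp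
    ring

theorem sum_divisors_moebius_of_dvd {m : ℕ} (hm : m ≠ 0) (n : ℕ) :
    ∑ d ∈ m.divisors, (if d ∣ n then ((ArithmeticFunction.moebius d : ℤ) : ℂ) else 0) =
      if n.Coprime m then 1 else 0 := by
  have h1 : ∑ d ∈ m.divisors, (if d ∣ n then ((ArithmeticFunction.moebius d : ℤ) : ℂ) else 0) =
      ((∑ d ∈ (n.gcd m).divisors, ArithmeticFunction.moebius d : ℤ) : ℂ) := by
    rw [← Finset.sum_filter, Int.cast_sum]
    refine Finset.sum_congr ?_ fun _ _ => rfl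
    ext d
    have : n.gcd m ≠ 0 := Nat.gcd_ne_zero_right hm
    simp only [Finset.mem_filter, Nat.mem_divisors, Nat.dvd_gcd_iff]
    tauto
  rw [h1, ← ArithmeticFunction.coe_mul_zeta_apply, ArithmeticFunction.moebius_mul_coe_zeta,
    ArithmeticFunction.one_apply]
  split_ifs <;> simp_all

theorem sum_divisors_norm_moebius_le (m : ℕ) :
    ∑ d ∈ m.divisors, ‖((ArithmeticFunction.moebius d : ℤ) : ℂ)‖ ≤ 2 ^ m.primeFactors.card := by
  have h1 : ∑ d ∈ m.divisors, ‖((ArithmeticFunction.moebius d : ℤ) : ℂ)‖ ≤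
      ∑ d ∈ m.divisors with Squarefree d, (1 : ℝ) := by
    rw [Finset.sum_filter]
    refine Finset.sum_le_sum fun d _ => ?_
    rw [Complex.norm_intCast]
    split_ifs with h
    · exact_mod_cast ArithmeticFunction.abs_moebius_le_one
    · simp [ArithmeticFunction.moebius_eq_zero_of_not_squarefree h]
  refine h1.trans ?_
  rw [Finset.sum_const, nsmul_eq_mul, mul_one, ← Nat.cast_ofNat, ← Nat.cast_pow,
    ← Finset.card_powerset]
  refine Nat.cast_le.2 (Finset.card_le_card_of_injOn Nat.primeFactors ?_ ?_)
  · intro d hd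
    simp only [Finset.coe_filter, Set.mem_ofPred_eq, Nat.mem_divisors] at hd
    exact Finset.mem_coe.2 (Finset.mem_powerset.2 (Nat.primeFactors_mono hd.1.1 hd.1.2))
  · intro a ha b hb hab
    simp only [Finset.coe_filter, Set.mem_ofPred_eq] at ha hb
    rw [← Nat.prod_primeFactors_of_squarefree ha.2, ← Nat.prod_primeFactors_of_squarefree hb.2, hab]

theorem factorial_card_le_prod {s : Finset ℕ} (hs : ∀ x ∈ s, 0 < x) :
    s.card.factorial ≤ ∏ x ∈ s, x := by
  induction s using Finset.induction_on_max with
  | empty => simp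
  | insert a s ha ih =>
    have has : a ∉ s := fun h => lt_irrefl _ (ha a h)
    rw [Finset.prod_insert has, Finset.card_insert_of_notMem has, Nat.factorial_succ]
    refine Nat.mul_le_mul ?_ (ih fun x hx => hs x (Finset.mem_insert_of_mem hx))
    have hsub : s ⊆ Finset.Ico 1 a := fun x hx =>
      Finset.mem_Ico.2 ⟨hs x (Finset.mem_insert_of_mem hx), ha x hx⟩
    have h1 := Finset.card_le_card hsub
    have h2 := hs a (Finset.mem_insert_self a s)
    rw [Nat.card_Ico] at h1
    omega

theorem two_pow_card_primeFactors_le {ε : ℝ} (hε : 0 < ε) :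
    ∃ C : ℝ, 0 < C ∧ ∀ m : ℕ, m ≠ 0 → (2 : ℝ) ^ m.primeFactors.card ≤ C * (m : ℝ) ^ ε := by
  obtain ⟨K, hK⟩ := exists_nat_gt (1 / ε)
  have hKpos : (0 : ℝ) < K := lt_trans (by positivity) hK
  have hK0 : K ≠ 0 := by rintro rfl; simp at hKpos
  refine ⟨Real.exp (2 ^ K) ^ ((1 : ℝ) / K), by positivity, fun m hm => ?_⟩
  have hm1 : (1 : ℝ) ≤ m := by exact_mod_cast Nat.one_le_iff_ne_zero.2 hm
  set w := m.primeFactors.card with hw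
  have h1 : ((w.factorial : ℕ) : ℝ) ≤ m := by
    refine Nat.cast_le.2 ((factorial_card_le_prod fun p hp => ?_).trans
      (Nat.le_of_dvd (Nat.pos_of_ne_zero hm) (Nat.prod_primeFactors_dvd m)))
    exact (Nat.prime_of_mem_primeFactors hp).pos
  have h2 : ((2 : ℝ) ^ w) ^ K ≤ Real.exp (2 ^ K) * m := by
    have h := Real.pow_div_factorial_le_exp ((2 : ℝ) ^ K) (by positivity) w
    rw [div_le_iff₀ (by positivity)] at h
    rw [← pow_mul, mul_comm, pow_mul]
    exact h.trans (by gcongr)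
  have h3 : (2 : ℝ) ^ w = (((2 : ℝ) ^ w) ^ K) ^ ((1 : ℝ) / K) := by
    rw [one_div, Real.pow_rpow_inv_natCast (by positivity) hK0]
  rw [h3]
  calc _ ≤ (Real.exp (2 ^ K) * m) ^ ((1 : ℝ) / K) := by gcongr
    _ = Real.exp (2 ^ K) ^ ((1 : ℝ) / K) * (m : ℝ) ^ ((1 : ℝ) / K) :=
      Real.mul_rpow (by positivity) (by positivity)
    _ ≤ _ := by
      gcongr
      rw [div_le_iff₀ hKpos]
      rw [div_lt_iff₀ hε] at hK
      linarith

theorem tsum_nat_twistedWeight_eq {m : ℕ} (χ : DirichletCharacter ℂ m) (M t : ℝ) :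
    ∑' n : ℕ, χ n * twistedWeight M t n = ∑' n : ℤ, χ n * twistedWeight M t n := by
  have h := Function.Injective.tsum_eq (g := fun n : ℕ => (n : ℤ)) Nat.cast_injective
    (f := fun n : ℤ => χ n * twistedWeight M t n) ?_
  · simpa using h
  · intro n hn
    by_contra hcon
    refine hn ?_
    have : n < 0 := by
      by_contra h
      exact hcon ⟨n.toNat, by simp; omega⟩
    have h2 : (n : ℝ) ≤ 0 := by exact_mod_cast this.le
    simp only
    rw [twistedWeight_of_nonpos h2, mul_zero]

theorem summable_twistedWeight_nat {M : ℝ} (hM : 0 < M) (t : ℝ) :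
    Summable fun n : ℕ => twistedWeight M t n := by
  have h := (summable_twistedWeight_int hM t 0).comp_injective
    (Nat.cast_injective (R := ℤ))
  simpa [Function.comp_def] using h

/-- The hybrid bound for arbitrary characters, with the main term for the principal one. -/
theorem norm_tsum_mul_twistedWeight_le {m : ℕ} [NeZero m] (χ : DirichletCharacter ℂ m)
    {M : ℝ} (hM : 0 < M) (t : ℝ) :
    ‖∑' n : ℕ, χ n * twistedWeight M t n‖ ≤ 2 ^ m.primeFactors.card *
      ((if χ = 1 then 216 * M * ((1 + |t|) ^ 2)⁻¹ else 0) + 36 * (√m * √(1 + |t|))) := by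
  have hm : m ≠ 0 := NeZero.ne m
  have : NeZero χ.conductor := ⟨χ.conductor_ne_zero⟩
  set ψ := χ.primitiveCharacter with hψ
  set B := (if χ = 1 then 216 * M * ((1 + |t|) ^ 2)⁻¹ else 0) + 36 * (√m * √(1 + |t|)) with hB
  have hcm : (χ.conductor : ℝ) ≤ m := by
    exact_mod_cast Nat.le_of_dvd (NeZero.pos m) χ.conductor_dvd_level
  have hinner : ∀ d : ℕ, d ≠ 0 →
      ∑' n : ℕ, (if d ∣ n then ψ n * twistedWeight M t n else 0) =
      ψ d * (d : ℂ) ^ (-(t * I)) * ∑' k : ℕ, ψ k * twistedWeight (M / d) t k := by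
    intro d hd
    have hd' : (0 : ℝ) < d := by exact_mod_cast Nat.pos_of_ne_zero hd
    have h := Function.Injective.tsum_eq (g := fun k : ℕ => d * k)
      (mul_right_injective₀ hd)
      (f := fun n : ℕ => if d ∣ n then ψ n * twistedWeight M t n else 0) ?_
    · rw [← h, ← tsum_mul_left]
      refine tsum_congr fun k => ?_
      rw [if_pos (dvd_mul_right d k)]
      push_cast
      rw [twistedWeight_mul hd', map_mul]
      push_cast
      ring
    · intro n hn
      have : d ∣ n := by
        by_contra hcon
        exact hn (if_neg hcon)
      obtain ⟨k, rfl⟩ := this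
      exact ⟨k, rfl⟩
  have hbound : ∀ d : ℕ, d ≠ 0 →
      ‖∑' n : ℕ, (if d ∣ n then ψ n * twistedWeight M t n else 0)‖ ≤ B := by
    intro d hd
    have hd' : (1 : ℝ) ≤ d := by exact_mod_cast Nat.one_le_iff_ne_zero.2 hd
    rw [hinner d hd, norm_mul, norm_mul, Complex.norm_natCast_cpow_of_pos (Nat.pos_of_ne_zero hd)]
    have h0 : (-(t * I)).re = 0 := by simp
    rw [h0, Real.rpow_zero, mul_one]
    refine (mul_le_of_le_one_left (norm_nonneg _) (DirichletCharacter.norm_le_one _ _)).trans ?_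
    rw [tsum_nat_twistedWeight_eq]
    refine (norm_tsum_primitive_mul_twistedWeight_le χ.primitiveCharacter_isPrimitive
      (by positivity) t).trans ?_
    have hiff := χ.eq_one_iff_conductor_eq_one
    rw [hB]
    by_cases h1 : χ = 1
    · rw [if_pos h1, if_pos (hiff.1 h1)]
      gcongr
      exact div_le_self hM.le hd'
    · rw [if_neg h1, if_neg (mt hiff.2 h1)]
      gcongr
  have hs : Summable fun n : ℕ => ψ n * twistedWeight M t n := by
    refine Summable.of_norm_bounded (summable_twistedWeight_nat hM t).norm fun n => ?_
    rw [norm_mul]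
    exact mul_le_of_le_one_left (norm_nonneg _) (DirichletCharacter.norm_le_one _ _)
  have hexp : ∀ n : ℕ, χ n * twistedWeight M t n = ∑ d ∈ m.divisors,
      ((ArithmeticFunction.moebius d : ℤ) : ℂ) *
        (if d ∣ n then ψ n * twistedWeight M t n else 0) := by
    intro n
    have h1 : ∀ d ∈ m.divisors, ((ArithmeticFunction.moebius d : ℤ) : ℂ) *
        (if d ∣ n then ψ n * twistedWeight M t n else 0) =
        (if d ∣ n then ((ArithmeticFunction.moebius d : ℤ) : ℂ) else 0) *
          (ψ n * twistedWeight M t n) := by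
      intro d _
      split_ifs <;> simp
    rw [Finset.sum_congr rfl h1, ← Finset.sum_mul, sum_divisors_moebius_of_dvd hm]
    split_ifs with h
    · have := χ.primitiveCharacter_apply_of_isCoprime (a := n) (Nat.isCoprime_iff_coprime.2 h)
      simp only [Int.cast_natCast] at this
      rw [hψ, this, one_mul]
    · rw [MulChar.map_nonunit _ (by rwa [ZMod.isUnit_iff_coprime])]
      simp
  simp_rw [hexp]
  rw [Summable.tsum_finsetSum]
  · simp_rw [tsum_mul_left]
    refine (norm_sum_le _ _).trans ?_
    have hB0 : 0 ≤ B := (norm_nonneg _).trans (hbound 1 one_ne_zero)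
    calc _ ≤ ∑ d ∈ m.divisors, ‖((ArithmeticFunction.moebius d : ℤ) : ℂ)‖ * B := by
          refine Finset.sum_le_sum fun d hd => ?_
          rw [norm_mul]
          gcongr
          exact hbound d (Nat.pos_of_mem_divisors hd).ne'
      _ ≤ _ := by
          rw [← Finset.sum_mul]
          gcongr
          exact sum_divisors_norm_moebius_le m
  · intro d _
    refine Summable.mul_left _ (Summable.of_norm_bounded hs.norm fun n => ?_)
    split_ifs
    · exact le_rfl
    · rw [norm_zero]
      exact norm_nonneg _

/-- The Halász–Montgomery large values inequality, in weighted form. -/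
theorem sum_norm_sq_sum_mul_le_of_kernel {ι : Type*} (S : Finset ι) (A : Finset ℕ) {b : ℕ → ℝ}
    (hb0 : ∀ n, 0 ≤ b n) (hbs : Summable b) {c : ℝ} (hc : 0 < c) (hbA : ∀ n ∈ A, c ≤ b n)
    {φ : ι → ℕ → ℂ} (hφ : ∀ r n, ‖φ r n‖ ≤ 1) {B : ℝ} (hB0 : 0 ≤ B)
    (hB : ∀ r ∈ S, ∑ r' ∈ S, ‖∑' n, (b n : ℂ) * (φ r n * star (φ r' n))‖ ≤ B) (a : ℕ → ℂ) :
    ∑ r ∈ S, ‖∑ n ∈ A, a n * φ r n‖ ^ 2 ≤ B / c * ∑ n ∈ A, ‖a n‖ ^ 2 := by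
  set F : ι → ℂ := fun r => ∑ n ∈ A, a n * φ r n with hF
  set G : ℕ → ℂ := fun n => ∑ r ∈ S, star (F r) * φ r n with hG
  set K : ι → ι → ℂ := fun r r' => ∑' n, (b n : ℂ) * (φ r n * star (φ r' n)) with hK
  set X := ∑ r ∈ S, ‖F r‖ ^ 2 with hX
  set Y := ∑ n ∈ A, ‖a n‖ ^ 2 with hY
  have hX0 : 0 ≤ X := Finset.sum_nonneg fun _ _ => by positivity
  have hY0 : 0 ≤ Y := Finset.sum_nonneg fun _ _ => by positivity
  have hsum : ∀ r r', Summable fun n => (b n : ℂ) * (φ r n * star (φ r' n)) := by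
    intro r r'
    refine Summable.of_norm_bounded hbs fun n => ?_
    rw [norm_mul, norm_mul, norm_star, Complex.norm_real, Real.norm_of_nonneg (hb0 n)]
    exact mul_le_of_le_one_right (hb0 n)
      (mul_le_one₀ (hφ r n) (norm_nonneg _) (hφ r' n))
  have hKsymm : ∀ r r', ‖K r r'‖ = ‖K r' r‖ := by
    intro r r'
    rw [← norm_star (K r r'), hK]
    simp only
    rw [tsum_star]
    congr 1
    refine tsum_congr fun n => ?_
    simp only [star_mul', Complex.star_def, Complex.conj_ofReal, Complex.conj_conj]
    ring
  have hXG : (X : ℂ) = ∑ n ∈ A, a n * G n := by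
    rw [hX, hG]
    push_cast
    simp_rw [Finset.mul_sum]
    rw [Finset.sum_comm]
    refine Finset.sum_congr rfl fun r _ => ?_
    rw [← Complex.mul_conj', hF]
    simp only
    rw [Finset.sum_mul]
    exact Finset.sum_congr rfl fun n _ => by simp only [starRingEnd_apply]; ring
  have hexp : ∀ n, ((b n * ‖G n‖ ^ 2 : ℝ) : ℂ) = ∑ r ∈ S, ∑ r' ∈ S,
      (star (F r) * F r') * ((b n : ℂ) * (φ r n * star (φ r' n))) := by
    intro n
    push_cast
    rw [← Complex.mul_conj', hG]
    simp only [map_sum]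
    rw [Finset.sum_mul_sum, Finset.mul_sum]
    refine Finset.sum_congr rfl fun r _ => ?_
    rw [Finset.mul_sum]
    refine Finset.sum_congr rfl fun r' _ => ?_
    simp only [starRingEnd_apply, star_mul', star_star]
    ring
  have hGs : HasSum (fun n => ((b n * ‖G n‖ ^ 2 : ℝ) : ℂ))
      (∑ r ∈ S, ∑ r' ∈ S, (star (F r) * F r') * K r r') := by
    simp_rw [hexp]
    exact hasSum_sum fun r _ => hasSum_sum fun r' _ => ((hsum r r').hasSum).mul_left _
  have hGle : ∑' n, b n * ‖G n‖ ^ 2 ≤ B * X := by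
    have h1 : ‖((∑' n, b n * ‖G n‖ ^ 2 : ℝ) : ℂ)‖ ≤ B * X := by
      rw [Complex.ofReal_tsum, hGs.tsum_eq]
      calc _ ≤ ∑ r ∈ S, ∑ r' ∈ S, (‖F r‖ ^ 2 / 2 * ‖K r r'‖ + ‖F r'‖ ^ 2 / 2 * ‖K r' r‖) := by
            refine (norm_sum_le _ _).trans (Finset.sum_le_sum fun r _ =>
              (norm_sum_le _ _).trans (Finset.sum_le_sum fun r' _ => ?_))
            rw [norm_mul, norm_mul, norm_star, hKsymm r' r, ← add_mul]
            gcongr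
            nlinarith [sq_nonneg (‖F r‖ - ‖F r'‖)]
        _ = ∑ r ∈ S, ∑ r' ∈ S, ‖F r‖ ^ 2 * ‖K r r'‖ := by
            simp_rw [Finset.sum_add_distrib]
            rw [Finset.sum_comm (f := fun r r' => ‖F r'‖ ^ 2 / 2 * ‖K r' r‖),
              ← Finset.sum_add_distrib]
            refine Finset.sum_congr rfl fun r _ => ?_
            rw [← Finset.sum_add_distrib]
            exact Finset.sum_congr rfl fun r' _ => by ring
        _ ≤ ∑ r ∈ S, ‖F r‖ ^ 2 * B := by
            refine Finset.sum_le_sum fun r hr => ?_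
            rw [← Finset.mul_sum]
            exact mul_le_mul_of_nonneg_left (hB r hr) (by positivity)
        _ = _ := by rw [← Finset.sum_mul, mul_comm]
    exact (le_abs_self _).trans (by rwa [Complex.norm_real, Real.norm_eq_abs] at h1)
  have hGA : ∑ n ∈ A, ‖G n‖ ^ 2 ≤ B * X / c := by
    rw [le_div_iff₀ hc, Finset.sum_mul]
    refine le_trans (Finset.sum_le_sum fun n hn => ?_)
      (((Complex.hasSum_ofReal.1 (by
        rw [Complex.ofReal_tsum]; exact hGs.summable.hasSum :
        HasSum (fun n => ((b n * ‖G n‖ ^ 2 : ℝ) : ℂ))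
          ((∑' n, b n * ‖G n‖ ^ 2 : ℝ) : ℂ))).summable.sum_le_tsum A fun n _ =>
            mul_nonneg (hb0 n) (by positivity)).trans hGle)
    rw [mul_comm]
    exact mul_le_mul_of_nonneg_right (hbA n hn) (by positivity)
  have hX2 : X ^ 2 ≤ Y * (B * X / c) := by
    have h1 : X ≤ ∑ n ∈ A, ‖a n‖ * ‖G n‖ := by
      calc X = ‖(X : ℂ)‖ := by rw [Complex.norm_real, Real.norm_of_nonneg hX0]
        _ ≤ _ := by
          rw [hXG]
          refine (norm_sum_le _ _).trans (le_of_eq ?_)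
          exact Finset.sum_congr rfl fun _ _ => norm_mul _ _
    calc X ^ 2 ≤ (∑ n ∈ A, ‖a n‖ * ‖G n‖) ^ 2 := by gcongr
      _ ≤ Y * ∑ n ∈ A, ‖G n‖ ^ 2 := Finset.sum_mul_sq_le_sq_mul_sq _ _ _
      _ ≤ _ := by gcongr
  rcases hX0.eq_or_lt with h | h
  · rw [← h]; positivity
  · refine le_of_mul_le_mul_right ?_ h
    calc X * X = X ^ 2 := by ring
      _ ≤ _ := hX2
      _ = _ := by ring

theorem sum_inv_sq_le_of_le {δ : ℝ} (hδ : 0 < δ) {s : Finset ℝ} (t : ℝ) (hs : ∀ x ∈ s, t ≤ x)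
    (hsep : ∀ x ∈ s, ∀ y ∈ s, x ≠ y → δ ≤ |x - y|) :
    ∑ x ∈ s, ((1 + |t - x|) ^ 2)⁻¹ ≤ 1 + δ⁻¹ := by
  have hX : 0 < δ⁻¹ := by positivity
  set k : ℝ → ℕ := fun x => ⌊(x - t) / δ⌋₊ with hk
  have hnn : ∀ x ∈ s, 0 ≤ (x - t) / δ := fun x hx => div_nonneg (sub_nonneg.2 (hs x hx)) hδ.le
  have hinj : Set.InjOn k s := by
    intro x hx y hy hxy
    by_contra hne
    have h1 := hsep x hx y hy hne
    have h2 := Nat.floor_le (hnn x hx)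
    have h3 := Nat.lt_floor_add_one ((x - t) / δ)
    have h4 := Nat.floor_le (hnn y hy)
    have h5 := Nat.lt_floor_add_one ((y - t) / δ)
    simp only [hk] at hxy
    rw [hxy] at h2 h3
    have h6 : |(x - t) / δ - (y - t) / δ| < 1 := by rw [abs_lt]; constructor <;> linarith
    rw [← sub_div, abs_div, abs_of_pos hδ, div_lt_one hδ] at h6
    ring_nf at h6 h1
    linarith
  have hterm : ∀ x ∈ s, ((1 + |t - x|) ^ 2)⁻¹ ≤ (δ⁻¹ / (δ⁻¹ + k x)) ^ 2 := by
    intro x hx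
    have h2 := Nat.floor_le (hnn x hx)
    rw [le_div_iff₀ hδ] at h2
    have : δ⁻¹ / (δ⁻¹ + k x) = (1 + δ * k x)⁻¹ := by field_simp
    rw [this, inv_pow]
    gcongr
    rw [abs_sub_comm, abs_of_nonneg (sub_nonneg.2 (hs x hx))]
    linarith
  refine (Finset.sum_le_sum hterm).trans ?_
  rw [← Finset.sum_image (f := fun i : ℕ => (δ⁻¹ / (δ⁻¹ + i)) ^ 2) hinj]
  obtain ⟨K, hK⟩ := Finset.exists_nat_subset_range (s.image k)
  calc _ ≤ ∑ i ∈ Finset.range (K + 1), (δ⁻¹ / (δ⁻¹ + i)) ^ 2 := by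
        refine Finset.sum_le_sum_of_subset_of_nonneg
          (hK.trans (Finset.range_mono (Nat.le_succ K))) fun _ _ _ => by positivity
    _ ≤ _ := by
        rw [Finset.sum_range_succ']
        have := sum_range_sq_div_add_le_self hX K
        have h0 : (δ⁻¹ / (δ⁻¹ + ((0 : ℕ) : ℝ))) ^ 2 = 1 := by
          rw [Nat.cast_zero, add_zero, div_self hX.ne', one_pow]
        push_cast at this h0 ⊢
        linarith

theorem sum_inv_sq_le_of_separated {δ : ℝ} (hδ : 0 < δ) {s : Finset ℝ} (t : ℝ)
    (hsep : ∀ x ∈ s, ∀ y ∈ s, x ≠ y → δ ≤ |x - y|) :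
    ∑ x ∈ s, ((1 + |t - x|) ^ 2)⁻¹ ≤ 2 * (δ⁻¹ + 1) := by
  rw [← Finset.sum_filter_add_sum_filter_not s (fun x => t ≤ x)]
  have h1 := sum_inv_sq_le_of_le hδ (s := s.filter fun x => t ≤ x) t
    (fun x hx => (Finset.mem_filter.1 hx).2)
    fun x hx y hy => hsep x (Finset.mem_filter.1 hx).1 y (Finset.mem_filter.1 hy).1
  have h2 := sum_inv_sq_le_of_le hδ (s := (s.filter fun x => ¬ t ≤ x).image Neg.neg) (-t)
    (by
      intro x hx
      obtain ⟨y, hy, rfl⟩ := Finset.mem_image.1 hx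
      have := (Finset.mem_filter.1 hy).2
      linarith)
    (by
      intro x hx y hy hxy
      obtain ⟨u, hu, rfl⟩ := Finset.mem_image.1 hx
      obtain ⟨v, hv, rfl⟩ := Finset.mem_image.1 hy
      have := hsep u (Finset.mem_filter.1 hu).1 v (Finset.mem_filter.1 hv).1 (by
        rintro rfl; exact hxy rfl)
      rwa [← abs_neg, show -(-u - -v) = u - v by ring])
  rw [Finset.sum_image neg_injective.injOn] at h2
  have h3 : ∀ x : ℝ, |-t - -x| = |t - x| := fun x => by
    rw [← abs_neg, show -(-t - -x) = t - x by ring]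
  simp_rw [h3] at h2
  linarith

theorem rpow_neg_sub_rpow_neg_succ_le {κ : ℝ} (h0 : 0 ≤ κ) (h1 : κ < 1) {k : ℕ} (hk : 1 ≤ k) :
    (k : ℝ) ^ (-κ) - ((k + 1 : ℕ) : ℝ) ^ (-κ) ≤ (k : ℝ)⁻¹ := by
  have hk0 : (1 : ℝ) ≤ k := by exact_mod_cast hk
  have hkp : (0 : ℝ) < k := by linarith
  push_cast
  have e : ((k : ℝ) + 1) ^ (-κ) = (k : ℝ) ^ (-κ) * ((k : ℝ) / (k + 1)) ^ κ := by
    rw [Real.div_rpow hkp.le (by positivity), Real.rpow_neg hkp.le, Real.rpow_neg (by positivity)]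
    field_simp
  have h2 : (k : ℝ) / (k + 1) ≤ ((k : ℝ) / (k + 1)) ^ κ := by
    have hu : (k : ℝ) / (k + 1) ≤ 1 := by rw [div_le_one (by positivity)]; linarith
    simpa using Real.rpow_le_rpow_of_exponent_ge (by positivity) hu h1.le
  have h3 : (k : ℝ) ^ (-κ) ≤ 1 := Real.rpow_le_one_of_one_le_of_nonpos hk0 (by linarith)
  calc (k : ℝ) ^ (-κ) - ((k : ℝ) + 1) ^ (-κ)
      = (k : ℝ) ^ (-κ) * (1 - ((k : ℝ) / (k + 1)) ^ κ) := by rw [e]; ring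
    _ ≤ (k : ℝ) ^ (-κ) * (1 - (k : ℝ) / (k + 1)) := by gcongr
    _ ≤ 1 * (1 - (k : ℝ) / (k + 1)) := by
      gcongr
      rw [sub_nonneg, div_le_one (by positivity)]; linarith
    _ = (k + 1 : ℝ)⁻¹ := by field_simp; ring
    _ ≤ _ := by gcongr; linarith

theorem sum_Icc_mul_eq_sum_partial_sums (c : ℕ → ℂ) (w : ℕ → ℝ) (K : ℕ) :
    ∑ n ∈ Finset.Icc 1 K, c n * (w n : ℂ) =
      ∑ k ∈ Finset.Icc 1 K, ((w k - w (k + 1) : ℝ) : ℂ) * ∑ n ∈ Finset.Icc 1 k, c n +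
        (w (K + 1) : ℂ) * ∑ n ∈ Finset.Icc 1 K, c n := by
  induction K with
  | zero => simp
  | succ K ih =>
    simp only [Finset.sum_Icc_succ_top (Nat.le_add_left 1 K), ih]
    push_cast
    ring

theorem norm_sq_sum_mul_rpow_le {κ : ℝ} (h0 : 0 ≤ κ) (h1 : κ < 1) (c : ℕ → ℂ) (K : ℕ) :
    ‖∑ n ∈ Finset.Icc 1 K, c n * (((n : ℝ) ^ (-κ) : ℝ) : ℂ)‖ ^ 2 ≤
      ∑ k ∈ Finset.Icc 1 K, (k : ℝ)⁻¹ * ‖∑ n ∈ Finset.Icc 1 k, c n‖ ^ 2 +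
        ‖∑ n ∈ Finset.Icc 1 K, c n‖ ^ 2 := by
  set w : ℕ → ℝ := fun n => (n : ℝ) ^ (-κ) with hw
  set A : ℕ → ℝ := fun k => ‖∑ n ∈ Finset.Icc 1 k, c n‖ with hA
  have hp : ∀ k ∈ Finset.Icc 1 K, 0 ≤ w k - w (k + 1) := by
    intro k hk
    have : (0 : ℝ) < k := by exact_mod_cast (Finset.mem_Icc.1 hk).1
    rw [sub_nonneg]
    exact Real.rpow_le_rpow_of_nonpos this (by push_cast; linarith) (by linarith)
  have hv : 0 ≤ w (K + 1) := by positivity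
  set v := w (K + 1)
  set P := ∑ k ∈ Finset.Icc 1 K, (w k - w (k + 1)) with hP
  have hP0 : 0 ≤ P := Finset.sum_nonneg hp
  have hPv : P + v = 1 := by
    have h3 : ∀ K : ℕ, ∑ k ∈ Finset.Icc 1 K, (w k - w (k + 1)) + w (K + 1) = 1 := by
      intro K
      induction K with
      | zero => simp [hw]
      | succ K ih => rw [Finset.sum_Icc_succ_top (Nat.le_add_left 1 K)]; linarith
    exact h3 K
  set y := ∑ k ∈ Finset.Icc 1 K, (w k - w (k + 1)) * A k with hy
  set D := ∑ k ∈ Finset.Icc 1 K, (w k - w (k + 1)) * A k ^ 2 with hD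
  have hyPD : y ^ 2 ≤ P * D :=
    Finset.sum_sq_le_sum_mul_sum_of_sq_le_mul _ hp
      (fun k hk => mul_nonneg (hp k hk) (sq_nonneg _)) fun k _ => le_of_eq (by ring)
  have hmain : (y + v * A K) ^ 2 ≤ D + v * A K ^ 2 := by
    rcases hP0.eq_or_lt with h | h
    · have hD0 : 0 ≤ D := Finset.sum_nonneg fun k hk => mul_nonneg (hp k hk) (sq_nonneg _)
      rw [← h, zero_mul] at hyPD
      have hy0 : y = 0 := by
        have := sq_nonneg y
        exact pow_eq_zero_iff two_ne_zero |>.1 (le_antisymm hyPD this)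
      have hv1 : v = 1 := by linarith
      rw [hy0, hv1]
      linarith
    · refine le_of_mul_le_mul_left ?_ h
      have hPe : P = 1 - v := by linarith
      have : P * (D + v * A K ^ 2) - P * (y + v * A K) ^ 2 =
          (P * D - y ^ 2) + v * (y - P * A K) ^ 2 := by rw [hPe]; ring
      have h5 : 0 ≤ v * (y - P * A K) ^ 2 := by positivity
      linarith
  have hnorm : ‖∑ n ∈ Finset.Icc 1 K, c n * (w n : ℂ)‖ ≤ y + v * A K := by
    rw [sum_Icc_mul_eq_sum_partial_sums]
    refine (norm_add_le _ _).trans (add_le_add ((norm_sum_le _ _).trans (le_of_eq ?_)) ?_)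
    · refine Finset.sum_congr rfl fun k hk => ?_
      rw [norm_mul, Complex.norm_real, Real.norm_of_nonneg (hp k hk)]
    · rw [norm_mul, Complex.norm_real, Real.norm_of_nonneg hv]
  calc _ ≤ (y + v * A K) ^ 2 := by gcongr
    _ ≤ _ := hmain
    _ ≤ _ := by
      have hv1 : v ≤ 1 := by linarith
      refine add_le_add (Finset.sum_le_sum fun k hk => ?_)
        (mul_le_of_le_one_left (sq_nonneg _) hv1)
      exact mul_le_mul_of_nonneg_right
        (rpow_neg_sub_rpow_neg_succ_le h0 h1 (Finset.mem_Icc.1 hk).1) (sq_nonneg _)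

theorem exists_character_mul_star {q q' : ℕ} [NeZero q] [NeZero q'] (χ : DirichletCharacter ℂ q)
    (χ' : DirichletCharacter ℂ q') : ∃ ψ : DirichletCharacter ℂ (q * q'),
      (∀ n : ℕ, ψ n = χ n * star (χ' n)) ∧
      (χ.IsPrimitive → χ'.IsPrimitive → ψ = 1 →
        (⟨q, χ⟩ : Σ q, DirichletCharacter ℂ q) = ⟨q', χ'⟩) := by
  have h1 : q ∣ q * q' := dvd_mul_right q q'
  have h2 : q' ∣ q * q' := dvd_mul_left q' q
  refine ⟨χ.changeLevel h1 * (χ'⁻¹).changeLevel h2, fun n => ?_, fun hχ hχ' h => ?_⟩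
  · rw [MulChar.mul_apply, MulChar.star_apply']
    by_cases hn : n.Coprime (q * q')
    · have hc : IsCoprime (n : ℤ) ((q * q' : ℕ) : ℤ) := Nat.isCoprime_iff_coprime.2 hn
      have e1 := χ.changeLevel_eq_cast_of_dvd' h1 hc
      have e2 := (χ'⁻¹).changeLevel_eq_cast_of_dvd' h2 hc
      rw [Int.cast_natCast, Int.cast_natCast] at e1 e2
      rw [e1, e2]
    · rw [MulChar.map_nonunit _ (by rwa [ZMod.isUnit_iff_coprime]), zero_mul]
      rw [Nat.coprime_mul_iff_right, not_and_or] at hn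
      rcases hn with hn | hn
      · rw [MulChar.map_nonunit _ (by rwa [ZMod.isUnit_iff_coprime]), zero_mul]
      · rw [MulChar.map_nonunit χ'⁻¹ (by rwa [ZMod.isUnit_iff_coprime]), mul_zero]
  · rw [map_inv, mul_inv_eq_one] at h
    have hc := χ.conductor_changeLevel h1
    have hc' := χ'.conductor_changeLevel h2
    rw [h, hc', (DirichletCharacter.isPrimitive_def _).1 hχ,
      (DirichletCharacter.isPrimitive_def _).1 hχ'] at hc
    subst hc
    rw [DirichletCharacter.changeLevel_injective h1 h]

/-- The values `χ(n) n^{-it}`. -/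
noncomputable def characterTwist (r : Σ q, DirichletCharacter ℂ q) (t : ℝ) (n : ℕ) : ℂ :=
  r.2 n * (n : ℂ) ^ (-(t * I))

theorem norm_natCast_cpow_neg_mul_I_le (t : ℝ) (n : ℕ) : ‖(n : ℂ) ^ (-(t * I))‖ ≤ 1 := by
  rcases n.eq_zero_or_pos with rfl | hn
  · by_cases ht : -(t * I) = 0
    · rw [ht]
      simp
    · rw [Nat.cast_zero, Complex.zero_cpow ht]
      simp
  · rw [Complex.norm_natCast_cpow_of_pos hn]
    simp

theorem norm_characterTwist_le (r : Σ q, DirichletCharacter ℂ q) (t : ℝ) (n : ℕ) :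
    ‖characterTwist r t n‖ ≤ 1 := by
  rw [characterTwist, norm_mul]
  exact mul_le_one₀ (DirichletCharacter.norm_le_one _ _) (norm_nonneg _)
    (norm_natCast_cpow_neg_mul_I_le t n)

/-- A smooth majorant of the indicator function of `[1, 2^L)`, up to a constant. -/
noncomputable def dyadicWeight (L n : ℕ) : ℝ :=
  ∑ i ∈ Finset.range L, (n : ℝ) / 2 ^ i * Real.exp (-((n : ℝ) / 2 ^ i))

theorem dyadicWeight_nonneg (L n : ℕ) : 0 ≤ dyadicWeight L n :=
  Finset.sum_nonneg fun _ _ => by positivity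

theorem exp_neg_two_le_dyadicWeight {L n : ℕ} (hn : n ≠ 0) (hL : Nat.log 2 n < L) :
    Real.exp (-2) ≤ dyadicWeight L n := by
  refine le_trans ?_ (Finset.single_le_sum
    (f := fun i => (n : ℝ) / 2 ^ i * Real.exp (-((n : ℝ) / 2 ^ i)))
    (fun i _ => by positivity) (Finset.mem_range.2 hL))
  have h1 : (2 : ℝ) ^ Nat.log 2 n ≤ n := by exact_mod_cast Nat.pow_log_le_self 2 hn
  have h2 : (n : ℝ) ≤ 2 * 2 ^ Nat.log 2 n := by
    have := (Nat.lt_pow_succ_log_self (b := 2) (by norm_num) n).le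
    rw [pow_succ, mul_comm] at this
    exact_mod_cast this
  have hp : (0 : ℝ) < 2 ^ Nat.log 2 n := by positivity
  rw [← one_mul (Real.exp (-2))]
  gcongr
  · rwa [one_le_div hp]
  · rwa [div_le_iff₀ hp]

theorem twistedWeight_natCast_eq (M t t' : ℝ) (n : ℕ) :
    twistedWeight M (t - t') n = ((n / M * Real.exp (-(n / M)) : ℝ) : ℂ) *
      ((n : ℂ) ^ (-(t * I)) * star ((n : ℂ) ^ (-(t' * I)))) := by
  rcases n.eq_zero_or_pos with rfl | hn
  · rw [twistedWeight_of_nonpos (by simp)]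
    simp
  · have hn' : (0 : ℝ) < n := by exact_mod_cast hn
    have hnc : (n : ℂ) ≠ 0 := by exact_mod_cast hn.ne'
    have hstar : star ((n : ℂ) ^ (-(t' * I))) = (n : ℂ) ^ (t' * I) := by
      have := Complex.cpow_conj (n : ℂ) (-(t' * I)) (by
        rw [Complex.natCast_arg]; exact Real.pi_pos.ne)
      rw [Complex.star_def]
      simp only [map_neg, map_mul, Complex.conj_ofReal, Complex.conj_I, map_natCast] at this
      rw [← this]
      congr 1
      ring
    rw [twistedWeight_of_pos hn', hstar, ← Complex.cpow_add _ _ hnc]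
    have e : (1 : ℂ) - ((t - t' : ℝ) : ℂ) * I = 1 + (-(t * I) + t' * I) := by push_cast; ring
    rw [e, Complex.ofReal_natCast, Complex.cpow_add _ _ hnc, Complex.cpow_one]
    push_cast
    ring

theorem summable_dyadicWeight (L : ℕ) : Summable (dyadicWeight L) := by
  refine summable_sum fun i _ => ?_
  have hM : (0 : ℝ) < 2 ^ i := by positivity
  refine (summable_twistedWeight_nat hM 0).norm.congr fun n => ?_
  rcases n.eq_zero_or_pos with rfl | hn
  · rw [twistedWeight_of_nonpos (by simp)]
    simp
  · rw [norm_twistedWeight_of_pos hM (by exact_mod_cast hn)]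

theorem norm_tsum_dyadicWeight_mul_le {r r' : Σ q, DirichletCharacter ℂ q} (hr0 : r.1 ≠ 0)
    (hr0' : r'.1 ≠ 0) (hr : r.2.IsPrimitive) (hr' : r'.2.IsPrimitive) (t t' : ℝ) (L : ℕ)
    [Decidable (r = r')] :
    ‖∑' n, (dyadicWeight L n : ℂ) * (characterTwist r t n * star (characterTwist r' t' n))‖ ≤
      2 ^ (r.1 * r'.1).primeFactors.card *
        ((if r = r' then 216 * 2 ^ L * ((1 + |t - t'|) ^ 2)⁻¹ else 0) +
          L * (36 * (√(r.1 * r'.1) * √(1 + |t - t'|)))) := by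
  obtain ⟨q, χ⟩ := r
  obtain ⟨q', χ'⟩ := r'
  simp only at hr0 hr0' hr hr' ⊢
  have : NeZero q := ⟨hr0⟩
  have : NeZero q' := ⟨hr0'⟩
  obtain ⟨ψ, hψ, hψ1⟩ := exists_character_mul_star χ χ'
  have h1 : ∀ n : ℕ, (dyadicWeight L n : ℂ) *
      (characterTwist ⟨q, χ⟩ t n * star (characterTwist ⟨q', χ'⟩ t' n)) =
      ∑ i ∈ Finset.range L, ψ n * twistedWeight (2 ^ i) (t - t') n := by
    intro n
    rw [dyadicWeight, Complex.ofReal_sum, Finset.sum_mul]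
    refine Finset.sum_congr rfl fun i _ => ?_
    rw [twistedWeight_natCast_eq, hψ]
    simp only [characterTwist, star_mul']
    ring
  have hs : ∀ i ∈ Finset.range L, Summable fun n : ℕ =>
      ψ n * twistedWeight (2 ^ i) (t - t') n := by
    intro i _
    refine Summable.of_norm_bounded
      (summable_twistedWeight_nat (M := 2 ^ i) (by positivity) (t - t')).norm fun n => ?_
    rw [norm_mul]
    exact mul_le_of_le_one_left (norm_nonneg _) (DirichletCharacter.norm_le_one _ _)
  simp_rw [h1]
  rw [Summable.tsum_finsetSum hs]
  refine (norm_sum_le _ _).trans ((Finset.sum_le_sum fun i _ =>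
    norm_tsum_mul_twistedWeight_le ψ (M := 2 ^ i) (by positivity) (t - t')).trans ?_)
  rw [← Finset.mul_sum, Finset.sum_add_distrib, Finset.sum_const, Finset.card_range, nsmul_eq_mul]
  push_cast
  gcongr
  have hgeom : ∑ i ∈ Finset.range L, (2 : ℝ) ^ i ≤ 2 ^ L := by
    rw [geom_sum_eq (by norm_num)]
    norm_num
  by_cases h : ψ = 1
  · rw [if_pos (hψ1 hr hr' h)]
    simp only [if_pos h]
    rw [← Finset.sum_mul, ← Finset.mul_sum]
    gcongr
  · simp only [if_neg h, Finset.sum_const_zero]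
    split_ifs <;> positivity

/-- The constant in the large values estimate for families of primitive characters. -/
noncomputable def largeValuesBound (W Q T δ R : ℝ) (L : ℕ) : ℝ :=
  W * (216 * 2 ^ L * (2 * (δ⁻¹ + 1)) + L * (36 * (2 * Q * √(3 * T))) * R)

theorem largeValuesBound_nonneg {W Q T δ R : ℝ} (hW : 0 ≤ W) (hQ : 0 ≤ Q) (hδ : 0 < δ)
    (hR : 0 ≤ R) (L : ℕ) : 0 ≤ largeValuesBound W Q T δ R L := by
  unfold largeValuesBound
  positivity

open Classical in
theorem sum_norm_sq_sum_mul_characterTwist_le {P : Finset (Σ q, DirichletCharacter ℂ q)}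
    {𝒯 : (Σ q, DirichletCharacter ℂ q) → Finset ℝ} {Q T δ W : ℝ} (hQ : 0 ≤ Q) (hT : 2 ≤ T)
    (hδ : 0 < δ) (hP : ∀ r ∈ P, r.1 ≠ 0 ∧ r.2.IsPrimitive ∧ (r.1 : ℝ) ≤ 2 * Q)
    (h𝒯 : ∀ r ∈ P, ∀ t ∈ 𝒯 r, |t| ≤ T)
    (hsep : ∀ r ∈ P, ∀ t ∈ 𝒯 r, ∀ t' ∈ 𝒯 r, t ≠ t' → δ ≤ |t - t'|)
    (hW0 : 0 ≤ W)
    (hW : ∀ m : ℕ, m ≠ 0 → (m : ℝ) ≤ (2 * Q) ^ 2 → (2 : ℝ) ^ m.primeFactors.card ≤ W)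
    {L : ℕ} {A : Finset ℕ} (hA : ∀ n ∈ A, n ≠ 0 ∧ Nat.log 2 n < L) (a : ℕ → ℂ) :
    ∑ r ∈ P, ∑ t ∈ 𝒯 r, ‖∑ n ∈ A, a n * characterTwist r t n‖ ^ 2 ≤
      largeValuesBound W Q T δ (∑ r ∈ P, ((𝒯 r).card : ℝ)) L / Real.exp (-2) *
        ∑ n ∈ A, ‖a n‖ ^ 2 := by
  have hR0 : 0 ≤ ∑ r ∈ P, ((𝒯 r).card : ℝ) := Finset.sum_nonneg fun _ _ => by positivity
  have h := sum_norm_sq_sum_mul_le_of_kernel (P.sigma 𝒯) A (dyadicWeight_nonneg L)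
    (summable_dyadicWeight L) (Real.exp_pos (-2))
    (fun n hn => exp_neg_two_le_dyadicWeight (hA n hn).1 (hA n hn).2)
    (φ := fun x => characterTwist x.1 x.2) (fun x => norm_characterTwist_le x.1 x.2)
    (B := largeValuesBound W Q T δ (∑ r ∈ P, ((𝒯 r).card : ℝ)) L)
    (largeValuesBound_nonneg hW0 hQ hδ hR0 L) ?_ a
  · rwa [Finset.sum_sigma] at h
  · rintro ⟨r, t⟩ hx
    obtain ⟨hr, ht⟩ := Finset.mem_sigma.1 hx
    simp only at hr ht ⊢
    rw [Finset.sum_sigma]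
    obtain ⟨hr0, hrp, hrQ⟩ := hP r hr
    have hterm : ∀ r' ∈ P, ∀ t' ∈ 𝒯 r',
        ‖∑' n, (dyadicWeight L n : ℂ) * (characterTwist r t n * star (characterTwist r' t' n))‖ ≤
        W * ((if r = r' then 216 * 2 ^ L * ((1 + |t - t'|) ^ 2)⁻¹ else 0) +
          L * (36 * (2 * Q * √(3 * T)))) := by
      intro r' hr' t' ht'
      obtain ⟨hr0', hrp', hrQ'⟩ := hP r' hr'
      have hmul : (r.1 : ℝ) * r'.1 ≤ (2 * Q) ^ 2 := by
        rw [pow_two]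
        gcongr
      have htt : 1 + |t - t'| ≤ 3 * T := by
        have := abs_sub t t'
        have := h𝒯 r hr t ht
        have := h𝒯 r' hr' t' ht'
        linarith
      refine (norm_tsum_dyadicWeight_mul_le hr0 hr0' hrp hrp' t t' L).trans ?_
      gcongr
      · exact hW _ (mul_ne_zero hr0 hr0') (by exact_mod_cast hmul)
      · rw [Real.sqrt_le_left (by positivity)]
        exact hmul
    refine (Finset.sum_le_sum fun r' hr' => Finset.sum_le_sum (hterm r' hr')).trans ?_
    simp_rw [← Finset.mul_sum, Finset.sum_add_distrib, Finset.sum_const, nsmul_eq_mul,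
      ← Finset.sum_mul]
    rw [largeValuesBound]
    refine mul_le_mul_of_nonneg_left (add_le_add ?_ (le_of_eq (by ring))) hW0
    rw [Finset.sum_eq_single_of_mem r hr]
    · simp only [if_true]
      rw [← Finset.mul_sum]
      gcongr
      exact sum_inv_sq_le_of_separated hδ t (hsep r hr)
    · intro r' _ hne
      exact Finset.sum_eq_zero fun _ _ => if_neg hne.symm

theorem sum_inv_Icc_le_one_add_log (K : ℕ) :
    ∑ k ∈ Finset.Icc 1 K, (k : ℝ)⁻¹ ≤ 1 + Real.log K := by
  have h := harmonic_le_one_add_log K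
  rw [harmonic_eq_sum_Icc] at h
  push_cast at h
  exact h

open Classical in
/-- The large values estimate along points with varying real parts. -/
theorem sum_norm_sq_sum_mul_characterTwist_rpow_le {P : Finset (Σ q, DirichletCharacter ℂ q)}
    {𝒯 : (Σ q, DirichletCharacter ℂ q) → Finset ℝ} {Q T δ W : ℝ} (hQ : 0 ≤ Q) (hT : 2 ≤ T)
    (hδ : 0 < δ) (hP : ∀ r ∈ P, r.1 ≠ 0 ∧ r.2.IsPrimitive ∧ (r.1 : ℝ) ≤ 2 * Q)
    (h𝒯 : ∀ r ∈ P, ∀ t ∈ 𝒯 r, |t| ≤ T)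
    (hsep : ∀ r ∈ P, ∀ t ∈ 𝒯 r, ∀ t' ∈ 𝒯 r, t ≠ t' → δ ≤ |t - t'|)
    (hW0 : 0 ≤ W)
    (hW : ∀ m : ℕ, m ≠ 0 → (m : ℝ) ≤ (2 * Q) ^ 2 → (2 : ℝ) ^ m.primeFactors.card ≤ W)
    {κ : (Σ q, DirichletCharacter ℂ q) → ℝ → ℝ}
    (hκ : ∀ r ∈ P, ∀ t ∈ 𝒯 r, 0 ≤ κ r t ∧ κ r t < 1) (K : ℕ) (a : ℕ → ℂ) :
    ∑ r ∈ P, ∑ t ∈ 𝒯 r,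
        ‖∑ n ∈ Finset.Icc 1 K, a n * characterTwist r t n * (((n : ℝ) ^ (-κ r t) : ℝ) : ℂ)‖ ^ 2 ≤
      (2 + Real.log K) *
        (largeValuesBound W Q T δ (∑ r ∈ P, ((𝒯 r).card : ℝ)) (Nat.log 2 K + 1) / Real.exp (-2) *
          ∑ n ∈ Finset.Icc 1 K, ‖a n‖ ^ 2) := by
  set D := largeValuesBound W Q T δ (∑ r ∈ P, ((𝒯 r).card : ℝ)) (Nat.log 2 K + 1) /
    Real.exp (-2) with hD
  have hD0 : 0 ≤ D := by
    have hR0 : 0 ≤ ∑ r ∈ P, ((𝒯 r).card : ℝ) := Finset.sum_nonneg fun _ _ => by positivity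
    rw [hD]
    exact div_nonneg (largeValuesBound_nonneg hW0 hQ hδ hR0 _) (Real.exp_pos _).le
  have hk : ∀ k ≤ K, ∑ r ∈ P, ∑ t ∈ 𝒯 r,
      ‖∑ n ∈ Finset.Icc 1 k, a n * characterTwist r t n‖ ^ 2 ≤
        D * ∑ n ∈ Finset.Icc 1 K, ‖a n‖ ^ 2 := by
    intro k hk
    have hsub : Finset.Icc 1 k ⊆ Finset.Icc 1 K := Finset.Icc_subset_Icc_right hk
    refine (sum_norm_sq_sum_mul_characterTwist_le hQ hT hδ hP h𝒯 hsep hW0 hW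
      (L := Nat.log 2 K + 1) (fun n hn => ?_) a).trans ?_
    · obtain ⟨h1, h2⟩ := Finset.mem_Icc.1 (hsub hn)
      exact ⟨by omega, Nat.lt_succ_of_le (Nat.log_mono_right h2)⟩
    · exact mul_le_mul_of_nonneg_left
        (Finset.sum_le_sum_of_subset_of_nonneg hsub fun _ _ _ => by positivity) hD0
  have hlog := sum_inv_Icc_le_one_add_log K
  have hY0 : 0 ≤ D * ∑ n ∈ Finset.Icc 1 K, ‖a n‖ ^ 2 :=
    mul_nonneg hD0 (Finset.sum_nonneg fun _ _ => by positivity)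
  calc _ ≤ ∑ r ∈ P, ∑ t ∈ 𝒯 r,
        (∑ k ∈ Finset.Icc 1 K, (k : ℝ)⁻¹ *
          ‖∑ n ∈ Finset.Icc 1 k, a n * characterTwist r t n‖ ^ 2 +
          ‖∑ n ∈ Finset.Icc 1 K, a n * characterTwist r t n‖ ^ 2) :=
        Finset.sum_le_sum fun r hr => Finset.sum_le_sum fun t ht =>
          norm_sq_sum_mul_rpow_le (hκ r hr t ht).1 (hκ r hr t ht).2 _ K
    _ = ∑ k ∈ Finset.Icc 1 K, (k : ℝ)⁻¹ * ∑ r ∈ P, ∑ t ∈ 𝒯 r,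
          ‖∑ n ∈ Finset.Icc 1 k, a n * characterTwist r t n‖ ^ 2 +
        ∑ r ∈ P, ∑ t ∈ 𝒯 r, ‖∑ n ∈ Finset.Icc 1 K, a n * characterTwist r t n‖ ^ 2 := by
        simp_rw [Finset.sum_add_distrib, Finset.mul_sum]
        congr 1
        rw [Finset.sum_comm]
        refine Finset.sum_congr rfl fun r _ => ?_
        rw [Finset.sum_comm]
    _ ≤ ∑ k ∈ Finset.Icc 1 K, (k : ℝ)⁻¹ * (D * ∑ n ∈ Finset.Icc 1 K, ‖a n‖ ^ 2) +
        D * ∑ n ∈ Finset.Icc 1 K, ‖a n‖ ^ 2 := by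
        refine add_le_add (Finset.sum_le_sum fun k hkK => ?_) (hk K le_rfl)
        exact mul_le_mul_of_nonneg_left (hk k (Finset.mem_Icc.1 hkK).2) (by positivity)
    _ ≤ _ := by
        rw [← Finset.sum_mul]
        nlinarith

theorem largeValuesBound_le {ε : ℝ} (hε : 0 < ε) {C₁ : ℝ} (hC₁ : 0 < C₁) :
    ∃ C : ℝ, 0 < C ∧ ∀ Q T N δ R : ℝ, 1 ≤ Q → 1 ≤ T → 1 ≤ N → 0 < δ → 0 ≤ R →
      (2 + Real.log ⌊N⌋₊) * (largeValuesBound (C₁ * ((2 * Q) ^ 2) ^ (ε / 6)) Q T δ R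
        (Nat.log 2 ⌊N⌋₊ + 1) / Real.exp (-2)) ≤
      C * (δ⁻¹ + 1) * (Q * T * N) ^ ε * (N + Q * T ^ ((1 : ℝ) / 2) * R) := by
  set D : ℝ := 2 + 3 / ε with hD
  have hD0 : 0 < D := by positivity
  refine ⟨D * Real.exp 2 * (C₁ * 4 ^ (ε / 6)) * (864 + 288 * D), by positivity, ?_⟩
  intro Q T N δ R hQ hT hN hδ hR
  have hfl : (⌊N⌋₊ : ℝ) ≤ N := Nat.floor_le (by linarith)
  have hfl1 : 1 ≤ ⌊N⌋₊ := Nat.le_floor (by simpa using hN)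
  have hfl1' : (1 : ℝ) ≤ ⌊N⌋₊ := by exact_mod_cast hfl1
  have hNe : 1 ≤ N ^ (ε / 3) := Real.one_le_rpow hN (by positivity)
  have hlogD : 2 + Real.log N ≤ D * N ^ (ε / 3) := by
    have h := Real.log_le_rpow_div (x := N) (by linarith) (show 0 < ε / 3 by positivity)
    have e : N ^ (ε / 3) / (ε / 3) = 3 / ε * N ^ (ε / 3) := by field_simp
    rw [e] at h
    rw [hD]
    linarith
  have hlog : Real.log ⌊N⌋₊ ≤ Real.log N := Real.log_le_log (by linarith) hfl
  have hpow : (2 : ℝ) ^ Nat.log 2 ⌊N⌋₊ ≤ N := by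
    refine le_trans ?_ hfl
    exact_mod_cast Nat.pow_log_le_self 2 (by omega)
  have hL : ((Nat.log 2 ⌊N⌋₊ + 1 : ℕ) : ℝ) ≤ 2 * (D * N ^ (ε / 3)) := by
    have h1 := Real.log_le_log (by positivity) hpow
    rw [Real.log_pow] at h1
    have h2 := Real.log_two_gt_d9
    have h3 : (0 : ℝ) ≤ (Nat.log 2 ⌊N⌋₊ : ℝ) := by positivity
    push_cast
    nlinarith
  have hL2 : (2 : ℝ) ^ (Nat.log 2 ⌊N⌋₊ + 1) ≤ 2 * N := by
    rw [pow_succ]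
    linarith
  have hsqrt : √(3 * T) ≤ 2 * T ^ ((1 : ℝ) / 2) := by
    rw [← Real.sqrt_eq_rpow, Real.sqrt_le_left (by positivity), mul_pow,
      Real.sq_sqrt (by linarith)]
    linarith
  have hW : C₁ * ((2 * Q) ^ 2) ^ (ε / 6) = C₁ * 4 ^ (ε / 6) * Q ^ (ε / 3) := by
    have e : (2 * Q) ^ 2 = 4 * Q ^ (2 : ℝ) := by
      rw [Real.rpow_two]; ring
    rw [e, Real.mul_rpow (by norm_num) (by positivity), ← Real.rpow_mul (by linarith)]
    ring_nf
  have hδ1 : 1 ≤ δ⁻¹ + 1 := by linarith [inv_pos.2 hδ]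
  have hT0 : 0 < T := by linarith
  have hQ0 : 0 < Q := by linarith
  have hN0 : 0 < N := by linarith
  set U := T ^ ((1 : ℝ) / 2) with hU
  have hU0 : 0 < U := by positivity
  have hexp : (Real.exp (-2))⁻¹ = Real.exp 2 := by rw [← Real.exp_neg, neg_neg]
  have hfin : N ^ (ε / 3) * Q ^ (ε / 3) * N ^ (ε / 3) ≤ (Q * T * N) ^ ε := by
    rw [Real.mul_rpow (by positivity) hN0.le, Real.mul_rpow hQ0.le hT0.le]
    have h1 : Q ^ (ε / 3) ≤ Q ^ ε := Real.rpow_le_rpow_of_exponent_le hQ (by linarith)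
    have h2 : N ^ (ε / 3) * N ^ (ε / 3) ≤ N ^ ε := by
      rw [← Real.rpow_add hN0]
      exact Real.rpow_le_rpow_of_exponent_le hN (by linarith)
    have h3 : 1 ≤ T ^ ε := Real.one_le_rpow hT hε.le
    calc _ = Q ^ (ε / 3) * 1 * (N ^ (ε / 3) * N ^ (ε / 3)) := by ring
      _ ≤ _ := by gcongr
  rw [largeValuesBound, hW, div_eq_mul_inv, hexp]
  calc _ ≤ D * N ^ (ε / 3) * (C₁ * 4 ^ (ε / 6) * Q ^ (ε / 3) *
        (216 * (2 * N) * (2 * (δ⁻¹ + 1)) +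
          (2 * (D * N ^ (ε / 3))) * (36 * (2 * Q * (2 * U))) * R) * Real.exp 2) := by
        gcongr
        linarith
    _ ≤ D * N ^ (ε / 3) * (C₁ * 4 ^ (ε / 6) * Q ^ (ε / 3) *
        ((864 + 288 * D) * (δ⁻¹ + 1) * N ^ (ε / 3) * (N + Q * U * R)) * Real.exp 2) := by
        gcongr
        have hx : 1 ≤ (δ⁻¹ + 1) * N ^ (ε / 3) := one_le_mul_of_one_le_of_one_le hδ1 hNe
        have hQU : 0 ≤ Q * U * R := by positivity
        have e1 : 216 * (2 * N) * (2 * (δ⁻¹ + 1)) ≤ 864 * (δ⁻¹ + 1) * N ^ (ε / 3) * N := by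
          have : (δ⁻¹ + 1) * N ≤ (δ⁻¹ + 1) * N * N ^ (ε / 3) :=
            le_mul_of_one_le_right (by positivity) hNe
          linarith
        have e2 : (2 * (D * N ^ (ε / 3))) * (36 * (2 * Q * (2 * U))) * R ≤
            288 * D * (δ⁻¹ + 1) * N ^ (ε / 3) * (Q * U * R) := by
          have : D * N ^ (ε / 3) * (Q * U * R) ≤
              D * N ^ (ε / 3) * (Q * U * R) * (δ⁻¹ + 1) :=
            le_mul_of_one_le_right (by positivity) hδ1
          linarith
        have e3 : 0 ≤ 864 * (δ⁻¹ + 1) * N ^ (ε / 3) * (Q * U * R) := by positivity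
        have e4 : 0 ≤ 288 * D * (δ⁻¹ + 1) * N ^ (ε / 3) * N := by positivity
        linarith
    _ = D * Real.exp 2 * (C₁ * 4 ^ (ε / 6)) * (864 + 288 * D) * (δ⁻¹ + 1) *
        (N ^ (ε / 3) * Q ^ (ε / 3) * N ^ (ε / 3)) * (N + Q * U * R) := by ring
    _ ≤ _ := by gcongr

open Classical in
theorem finsum_cond_eq_sum_sigma {ι M : Type*} {α : ι → Type*} [AddCommMonoid M]
    {p : (i : ι) → α i → Prop} {P : Finset (Σ i, α i)} (hP : ∀ r, r ∈ P ↔ p r.1 r.2)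
    (f : (i : ι) → α i → M) :
    ∑ᶠ (i : ι) (x : α i) (_ : p i x), f i x = ∑ r ∈ P, f r.1 r.2 := by
  set I : Finset ι := P.image Sigma.fst with hI
  set J : (i : ι) → Finset (α i) := fun i =>
    P.preimage (Sigma.mk i) sigma_mk_injective.injOn with hJ
  have hinner : ∀ i, ∑ᶠ (x : α i) (_ : p i x), f i x = ∑ x ∈ J i, f i x := fun i =>
    finsum_cond_eq_sum_of_cond_iff _ fun {x} _ => by
      rw [hJ, Finset.mem_preimage, hP]
  have hPs : P = I.sigma J := by
    ext ⟨i, x⟩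
    rw [Finset.mem_sigma, hJ, Finset.mem_preimage, hI]
    exact ⟨fun h => ⟨Finset.mem_image_of_mem Sigma.fst h, h⟩, fun h => h.2⟩
  simp_rw [hinner]
  rw [finsum_eq_sum_of_support_subset (s := I), hPs, Finset.sum_sigma]
  intro i hi
  obtain ⟨x, hx, -⟩ := Finset.exists_ne_zero_of_sum_ne_zero (Function.mem_support.1 hi)
  rw [hJ, Finset.mem_preimage] at hx
  exact Finset.mem_coe.2 (Finset.mem_image_of_mem Sigma.fst hx)

theorem finite_inFamily (j : ℕ) {Q : ℝ} (hQ : 0 ≤ Q) :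
    {r : Σ q, DirichletCharacter ℂ q | inFamily j Q r.1 r.2}.Finite := by
  have h : (⋃ q ∈ Finset.Icc 1 ⌊2 * Q⌋₊,
      Set.range (Sigma.mk q : DirichletCharacter ℂ q → Σ q, DirichletCharacter ℂ q)).Finite := by
    refine Set.Finite.biUnion (Finset.finite_toSet _) fun q hq => ?_
    have : NeZero q := ⟨by have := (Finset.mem_Icc.1 hq).1; omega⟩
    exact Set.finite_range _
  refine h.subset ?_
  rintro ⟨q, χ⟩ ⟨-, -, h1, h2⟩
  simp only at h1 h2
  refine Set.mem_biUnion (x := q) (Finset.mem_coe.2 (Finset.mem_Icc.2 ⟨?_, Nat.le_floor h2⟩))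
    ⟨χ, rfl⟩
  have : (0 : ℝ) < q := hQ.trans_lt h1
  exact_mod_cast this

theorem finsum_squarefree_le_eq {M : Type*} [AddCommMonoid M] {N : ℝ} (hN : 0 ≤ N) (f : ℕ → M) :
    ∑ᶠ (n : ℕ) (_ : Squarefree n ∧ (n : ℝ) ≤ N), f n =
      ∑ n ∈ Finset.Icc 1 ⌊N⌋₊, if Squarefree n then f n else 0 := by
  rw [← Finset.sum_filter]
  refine finsum_cond_eq_sum_of_cond_iff _ fun {n} _ => ?_
  rw [Finset.mem_filter, Finset.mem_Icc, Nat.le_floor_iff hN, and_comm]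
  exact and_congr_left fun h => ⟨fun hle => ⟨Nat.one_le_iff_ne_zero.2 h.ne_zero, hle⟩, And.right⟩

theorem stmt9 :
    ∀ ε > (0 : ℝ), ∃ C > (0 : ℝ), ∀ Q T N δ σ₀ : ℝ, 2 ≤ Q → 2 ≤ T → 2 ≤ N → 0 < δ →
      0 < σ₀ → σ₀ < 1 → ∀ j : ℕ, 2 ≤ j →
      ∀ 𝒯 : (q : ℕ) → DirichletCharacter ℂ q → Finset ℝ,
      (∀ (q : ℕ) (χ : DirichletCharacter ℂ q), inFamily j Q q χ →
        (∀ t ∈ 𝒯 q χ, δ/2 - T ≤ t ∧ t ≤ T - δ/2) ∧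
        (∀ t ∈ 𝒯 q χ, ∀ t' ∈ 𝒯 q χ, t ≠ t' → δ ≤ |t - t'|)) →
      ∀ σs : (q : ℕ) → DirichletCharacter ℂ q → ℝ → ℝ,
      (∀ (q : ℕ) (χ : DirichletCharacter ℂ q), inFamily j Q q χ →
        ∀ t ∈ 𝒯 q χ, σ₀ ≤ σs q χ t ∧ σs q χ t < 1) →
      ∀ a : ℕ → ℂ,
      (∑ᶠ (q : ℕ) (χ : DirichletCharacter ℂ q) (_ : inFamily j Q q χ),
          ∑ t ∈ 𝒯 q χ,
            ‖∑ᶠ (n : ℕ) (_ : Squarefree n ∧ (n : ℝ) ≤ N),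
                a n * χ (n : ZMod q) * (n : ℂ) ^ (-((σs q χ t : ℂ) + (t : ℂ) * I))‖ ^ 2)
        ≤ C * (δ⁻¹ + 1) * (Q * T * N) ^ ε *
            (N + Q * T ^ ((1 : ℝ)/2) *
              ∑ᶠ (q : ℕ) (χ : DirichletCharacter ℂ q) (_ : inFamily j Q q χ),
                ((𝒯 q χ).card : ℝ)) *
            ∑ᶠ (n : ℕ) (_ : Squarefree n ∧ (n : ℝ) ≤ N),
              ‖a n‖ ^ 2 * (n : ℝ) ^ (-(2 * σ₀)) := by
  intro ε hε
  obtain ⟨C₁, hC₁, hω⟩ := two_pow_card_primeFactors_le (show 0 < ε / 6 by positivity)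
  obtain ⟨C, hC, hbound⟩ := largeValuesBound_le hε hC₁
  refine ⟨C, hC, ?_⟩
  intro Q T N δ σ₀ hQ hT hN hδ hσ0 hσ1 j _ 𝒯 h𝒯 σs hσs a
  have hfin := finite_inFamily j (Q := Q) (by linarith)
  set P := hfin.toFinset with hPdef
  have hP : ∀ r : Σ q, DirichletCharacter ℂ q, r ∈ P ↔ inFamily j Q r.1 r.2 := fun r => by
    rw [hPdef, Set.Finite.mem_toFinset]
    rfl
  rw [finsum_cond_eq_sum_sigma hP, finsum_cond_eq_sum_sigma hP,
    finsum_squarefree_le_eq (by linarith)]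
  set K := ⌊N⌋₊ with hK
  set a' : ℕ → ℂ := fun n => if Squarefree n then a n * (((n : ℝ) ^ (-σ₀) : ℝ) : ℂ) else 0 with ha'
  have hY : ∑ n ∈ Finset.Icc 1 K,
      (if Squarefree n then ‖a n‖ ^ 2 * (n : ℝ) ^ (-(2 * σ₀)) else 0) =
      ∑ n ∈ Finset.Icc 1 K, ‖a' n‖ ^ 2 := by
    refine Finset.sum_congr rfl fun n _ => ?_
    simp only [ha']
    split_ifs
    · rw [norm_mul, Complex.norm_real, Real.norm_of_nonneg (by positivity), mul_pow,
        ← Real.rpow_natCast ((n : ℝ) ^ (-σ₀)), ← Real.rpow_mul (by positivity)]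
      congr 2
      push_cast
      ring
    · simp
  have hX : ∀ r ∈ P, ∀ t ∈ 𝒯 r.1 r.2,
      ∑ᶠ (n : ℕ) (_ : Squarefree n ∧ (n : ℝ) ≤ N),
        a n * r.2 (n : ZMod r.1) * (n : ℂ) ^ (-((σs r.1 r.2 t : ℂ) + (t : ℂ) * I)) =
      ∑ n ∈ Finset.Icc 1 K, a' n * characterTwist r t n *
        (((n : ℝ) ^ (-(σs r.1 r.2 t - σ₀)) : ℝ) : ℂ) := by
    intro r _ t _
    rw [finsum_squarefree_le_eq (by linarith)]
    refine Finset.sum_congr rfl fun n hn => ?_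
    have hn0 : (n : ℂ) ≠ 0 := by
      have := (Finset.mem_Icc.1 hn).1
      exact_mod_cast (by omega : n ≠ 0)
    simp only [ha', characterTwist]
    split_ifs
    · rw [Complex.ofReal_cpow (by positivity), Complex.ofReal_cpow (by positivity),
        Complex.ofReal_natCast]
      have e : -((σs r.1 r.2 t : ℂ) + (t : ℂ) * I) =
          ((-σ₀ : ℝ) : ℂ) + -(t * I) + ((-(σs r.1 r.2 t - σ₀) : ℝ) : ℂ) := by
        push_cast
        ring
      rw [e, Complex.cpow_add _ _ hn0, Complex.cpow_add _ _ hn0]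
      ring
    · simp
  rw [hY, Finset.sum_congr rfl fun r hr => Finset.sum_congr rfl fun t ht => by rw [hX r hr t ht]]
  have hY0 : 0 ≤ ∑ n ∈ Finset.Icc 1 K, ‖a' n‖ ^ 2 := Finset.sum_nonneg fun _ _ => by positivity
  have hR0 : 0 ≤ ∑ r ∈ P, ((𝒯 r.1 r.2).card : ℝ) := Finset.sum_nonneg fun _ _ => by positivity
  refine (sum_norm_sq_sum_mul_characterTwist_rpow_le (Q := Q) (P := P) (𝒯 := fun r => 𝒯 r.1 r.2)
    (κ := fun r t => σs r.1 r.2 t - σ₀) (W := C₁ * ((2 * Q) ^ 2) ^ (ε / 6)) (by linarith) hT hδ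
    ?_ ?_ ?_ (by positivity) ?_ ?_ K a').trans ?_
  · intro r hr
    obtain ⟨h1, -, h2, h3⟩ := (hP r).1 hr
    refine ⟨fun h0 => ?_, h1, h3⟩
    rw [h0, Nat.cast_zero] at h2
    linarith
  · intro r hr t ht
    obtain ⟨h1, h2⟩ := (h𝒯 r.1 r.2 ((hP r).1 hr)).1 t ht
    rw [abs_le]
    constructor <;> linarith
  · exact fun r hr => (h𝒯 r.1 r.2 ((hP r).1 hr)).2
  · intro m hm hmQ
    refine (hω m hm).trans ?_
    gcongr
  · intro r hr t ht
    obtain ⟨h1, h2⟩ := hσs r.1 r.2 ((hP r).1 hr) t ht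
    constructor <;> linarith
  · rw [← mul_assoc]
    exact mul_le_mul_of_nonneg_right
      (hbound Q T N δ _ (by linarith) (by linarith) (by linarith) hδ hR0) hY0
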